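/- arXiv:2407.07190 — 4 statements merged into one kernel-verified Lean document; each statement's English description precedes it below -/
import Mathlib

section
/- For every integer r ≥ 6 there exist a natural number m with m > (⌊r/3⌋)²/16 and a function f₀ : Perm(Fin r) → Fin m such that: for every permutation π ∈ Perm(Fin r) and every target m₀ ∈ Fin m, there exist j₀, j₁ ∈ Fin r such that f₀(π ∘ swap(j₀, j₁)) = m₀. That is, any one of the m output values can be forced by composing the input permutation with a single transposition (or the identity). -/
/-- The parity of the number of non-inversions of a triple. -/
def tripleParity {α : Type*} [LinearOrder α] (u : Fin 3 → α) : ZMod 2 :=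
  (if u 0 < u 1 then 1 else 0) + (if u 0 < u 2 then 1 else 0) + (if u 1 < u 2 then 1 else 0)

theorem tripleParity_congr {α β : Type*} [LinearOrder α] [LinearOrder β] {u : Fin 3 → α}
    {v : Fin 3 → β} (h : ∀ i j, u i < u j ↔ v i < v j) : tripleParity u = tripleParity v := by
  simp only [tripleParity, h]

set_option synthInstance.maxSize 4096 in
set_option synthInstance.maxHeartbeats 400000 in
theorem exists_swap_flip_tripleParity_fin_six :
    ∀ a b : Fin 6, a ≠ b → ∀ c, c ≠ a → c ≠ b → ∀ d, d ≠ a → d ≠ b → d ≠ c →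
      ∀ e, e ≠ a → e ≠ b → e ≠ c → e ≠ d →
      ∀ f, f ≠ a → f ≠ b → f ≠ c → f ≠ d → f ≠ e →
      ∃ i j : Fin 3,
        tripleParity (fun k => Sum.elim ![a, b, c] ![d, e, f]
          (Equiv.swap (Sum.inl i) (Sum.inr j) (Sum.inl k))) =
          tripleParity (fun k => Sum.elim ![a, b, c] ![d, e, f] (Sum.inl k)) + 1 ∧
        tripleParity (fun k => Sum.elim ![a, b, c] ![d, e, f]
          (Equiv.swap (Sum.inl i) (Sum.inr j) (Sum.inr k))) =
          tripleParity (fun k => Sum.elim ![a, b, c] ![d, e, f] (Sum.inr k)) + 1 := by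
  decide +kernel

/-- Given two disjoint triples of distinct elements of a linear order, some exchange of an entry of
one with an entry of the other changes the parity of both. -/
theorem exists_swap_flip_tripleParity {α : Type*} [LinearOrder α] (h : Fin 3 ⊕ Fin 3 → α)
    (hh : Function.Injective h) :
    ∃ i j : Fin 3,
      tripleParity (fun k => h (Equiv.swap (Sum.inl i) (Sum.inr j) (Sum.inl k))) =
        tripleParity (fun k => h (Sum.inl k)) + 1 ∧
      tripleParity (fun k => h (Equiv.swap (Sum.inl i) (Sum.inr j) (Sum.inr k))) =
        tripleParity (fun k => h (Sum.inr k)) + 1 := by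
  let s : Finset α := Finset.univ.image h
  have hs : s.card = 6 := by simp [s, Finset.card_image_of_injective _ hh]
  let σ : Fin 3 ⊕ Fin 3 → Fin 6 := fun x => (s.orderIsoOfFin hs).symm ⟨h x, by simp [s]⟩
  have hlt : ∀ x y, h x < h y ↔ σ x < σ y := fun x y => by simp [σ]
  have hσ : Function.Injective σ := fun x y hxy => hh (by simpa [σ] using hxy)
  have hσ' : Sum.elim ![σ (Sum.inl 0), σ (Sum.inl 1), σ (Sum.inl 2)]
      ![σ (Sum.inr 0), σ (Sum.inr 1), σ (Sum.inr 2)] = σ := by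
    ext x
    rcases x with x | x <;> fin_cases x <;> rfl
  obtain ⟨i, j, hl, hr⟩ := exists_swap_flip_tripleParity_fin_six
    (σ (Sum.inl 0)) (σ (Sum.inl 1)) (hσ.ne (by decide))
    (σ (Sum.inl 2)) (hσ.ne (by decide)) (hσ.ne (by decide))
    (σ (Sum.inr 0)) (hσ.ne (by decide)) (hσ.ne (by decide)) (hσ.ne (by decide))
    (σ (Sum.inr 1)) (hσ.ne (by decide)) (hσ.ne (by decide)) (hσ.ne (by decide))
    (hσ.ne (by decide))
    (σ (Sum.inr 2)) (hσ.ne (by decide)) (hσ.ne (by decide)) (hσ.ne (by decide))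
    (hσ.ne (by decide)) (hσ.ne (by decide))
  rw [hσ'] at hl hr
  refine ⟨i, j, ?_, ?_⟩
  · rw [tripleParity_congr fun _ _ => hlt _ _, hl]
    congr 1
    exact tripleParity_congr fun _ _ => (hlt _ _).symm
  · rw [tripleParity_congr fun _ _ => hlt _ _, hr]
    congr 1
    exact tripleParity_congr fun _ _ => (hlt _ _).symm

/-- If `ι` contains `2 * |V|` disjoint triples of positions, for a finite `ZMod 2`-module `V`, then
arrangements of elements of a linear order along `ι` can be labelled by `V × V` so that any label
is reached from any arrangement by one swap. -/
theorem exists_swap_encoding_of_embedding {ι V : Type*} [LinearOrder ι] [AddCommGroup V]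
    [Module (ZMod 2) V] [Fintype V] [DecidableEq V] (e : (V ⊕ V) × Fin 3 ↪ ι) :
    ∃ f : Equiv.Perm ι → V × V, ∀ (π : Equiv.Perm ι) (g : V × V),
      ∃ j₀ j₁ : ι, f (π * Equiv.swap j₀ j₁) = g := by
  let b (π : Equiv.Perm ι) (s : V ⊕ V) : ZMod 2 := tripleParity fun k => π (e (s, k))
  refine ⟨fun π => (∑ v, b π (Sum.inl v) • v, ∑ v, b π (Sum.inr v) • v), fun π g => ?_⟩
  obtain ⟨x, hx⟩ : ∃ x, (∑ v, b π (Sum.inl v) • v) + x = g.1 := ⟨_, add_sub_cancel _ _⟩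
  obtain ⟨y, hy⟩ : ∃ y, (∑ v, b π (Sum.inr v) • v) + y = g.2 := ⟨_, add_sub_cancel _ _⟩
  let p : Fin 3 ⊕ Fin 3 → ι :=
    fun z => e (Sum.elim (fun k => (Sum.inl x, k)) (fun k => (Sum.inr y, k)) z)
  have hp : Function.Injective p := e.injective.comp <| by
    rintro (k | k) (l | l) <;> simp
  obtain ⟨i, j, hl, hr⟩ := exists_swap_flip_tripleParity (π ∘ p) (π.injective.comp hp)
  refine ⟨p (Sum.inl i), p (Sum.inr j), ?_⟩
  set τ := Equiv.swap (p (Sum.inl i)) (p (Sum.inr j)) with hτ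
  have hswap : ∀ z, p (Equiv.swap (Sum.inl i) (Sum.inr j) z) = τ (p z) := fun z =>
    hp.map_swap ..
  simp only [Function.comp_apply, hswap] at hl hr
  have hbl : ∀ v, b (π * τ) (Sum.inl v) = b π (Sum.inl v) + if v = x then 1 else 0 := by
    intro v
    split_ifs with hv
    · subst hv
      exact hl
    · simp only [b, add_zero, Equiv.Perm.mul_apply]
      congr! 3 with k
      exact Equiv.swap_apply_of_ne_of_ne (e.injective.ne (by simp [hv])) (e.injective.ne (by simp))
  have hbr : ∀ v, b (π * τ) (Sum.inr v) = b π (Sum.inr v) + if v = y then 1 else 0 := by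
    intro v
    split_ifs with hv
    · subst hv
      exact hr
    · simp only [b, add_zero, Equiv.Perm.mul_apply]
      congr! 3 with k
      exact Equiv.swap_apply_of_ne_of_ne (e.injective.ne (by simp)) (e.injective.ne (by simp [hv]))
  ext1
  · simp [hbl, add_smul, Finset.sum_add_distrib, hx]
  · simp [hbr, add_smul, Finset.sum_add_distrib, hy]

/-- For every integer `r ≥ 6` there exist `m > (⌊r/3⌋)²/16` and a function
`f₀ : Perm (Fin r) → Fin m` such that any one of the `m` output values can be
forced by composing the input permutation with a single transposition
`swap j₀ j₁` (or the identity, when `j₀ = j₁`). -/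
theorem exists_swap_encoding (r : ℕ) (hr : 6 ≤ r) :
    ∃ m : ℕ, ((r / 3 : ℕ) : ℝ) ^ 2 / 16 < (m : ℝ) ∧
      ∃ f₀ : Equiv.Perm (Fin r) → Fin m,
        ∀ (π : Equiv.Perm (Fin r)) (m₀ : Fin m),
          ∃ j₀ j₁ : Fin r, f₀ (π * Equiv.swap j₀ j₁) = m₀ := by
  have hk : r / 3 / 2 ≠ 0 := by omega
  let t := Nat.log 2 (r / 3 / 2)
  have hle : 2 ^ t ≤ r / 3 / 2 := Nat.pow_log_le_self 2 hk
  have hlt : r / 3 / 2 < 2 ^ t * 2 := Nat.lt_pow_succ_log_self one_lt_two _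
  let V := Fin t → ZMod 2
  have hV : Fintype.card V = 2 ^ t := by simp [V, ZMod.card]
  obtain ⟨e⟩ : Nonempty ((V ⊕ V) × Fin 3 ↪ Fin r) := by
    apply Function.Embedding.nonempty_of_card_le
    simp only [Fintype.card_prod, Fintype.card_sum, Fintype.card_fin, hV]
    omega
  obtain ⟨f, hf⟩ := exists_swap_encoding_of_embedding e
  let E := Fintype.equivFin (V × V)
  refine ⟨Fintype.card (V × V), ?_, fun π => E (f π), fun π m₀ => ?_⟩
  · have h4 : ((r / 3 : ℕ) : ℝ) < 2 ^ t * 4 := by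
      exact_mod_cast (by omega : r / 3 < 2 ^ t * 4)
    rw [Fintype.card_prod, hV]
    push_cast
    nlinarith [Nat.cast_nonneg (α := ℝ) (r / 3)]
  · obtain ⟨j₀, j₁, h⟩ := hf π (E.symm m₀)
    exact ⟨j₀, j₁, by simp [h]⟩
end

section
/- There exists a constant C > 0 such that for every positive integer n and every real u with 1 ≤ u ≤ n there exists a set F of permutations of Fin n with |F| ≤ C · n · (4u)^{16u+4} having the following property: for every permutation π of Fin n there exists σ ∈ F such that every cycle of π ∘ σ has length at most n/u. -/
/-- The length of the cycle of the permutation `σ` containing `x`, i.e. the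
cardinality of the orbit of `x` under `σ`. -/
noncomputable def orbitSize {α : Type*} (σ : Equiv.Perm α) (x : α) : ℕ :=
  Set.ncard {z | σ.SameCycle x z}

/-- If `σ ^ k` fixes `x` for some positive `k`, the cycle of `x` has length at most `k`. -/
lemma orbitSize_le_of_pow_apply_eq {α : Type*} {σ : Equiv.Perm α} {x : α} {k : ℕ}
    (hk : 0 < k) (h : (σ ^ k) x = x) : orbitSize σ x ≤ k := by
  have hsub : {z | σ.SameCycle x z} ⊆ (fun i : ℕ => (σ ^ i) x) '' (Finset.range k : Set ℕ) := by
    rintro z ⟨i, rfl⟩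
    have hk' : (0 : ℤ) < k := by exact_mod_cast hk
    have hz : ∀ q : ℤ, ((σ ^ k) ^ q) x = x := fun q =>
      Equiv.Perm.zpow_apply_eq_self_of_apply_eq_self h q
    refine ⟨(i % k).toNat, ?_, ?_⟩
    · have h1 := Int.emod_lt_of_pos i hk'
      have h2 := Int.emod_nonneg i hk'.ne'
      simp only [Finset.coe_range, Set.mem_Iio]
      omega
    · have h2 := Int.emod_nonneg i hk'.ne'
      have h3 : i = ((i % k).toNat : ℤ) + k * (i / k) := by
        rw [Int.toNat_of_nonneg h2, Int.emod_add_mul_ediv]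
      have h4 : σ ^ i = σ ^ (i % k).toNat * (σ ^ k) ^ (i / k) := by
        conv_lhs => rw [h3]
        rw [zpow_add, zpow_mul, zpow_natCast, zpow_natCast]
      rw [h4, Equiv.Perm.mul_apply, hz]
  have hle := Set.ncard_le_ncard hsub (Finset.finite_toSet _ |>.image _)
  refine hle.trans ?_
  refine (Set.ncard_image_le (Finset.finite_toSet _)).trans ?_
  simp

lemma orbitSize_eq_of_sameCycle {α : Type*} {σ : Equiv.Perm α} {x y : α}
    (h : σ.SameCycle x y) : orbitSize σ x = orbitSize σ y := by
  unfold orbitSize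
  congr 1
  ext z
  exact ⟨fun hz => h.symm.trans hz, fun hz => h.trans hz⟩

/-- If every forward trajectory of `π` returns to its starting point or meets `S` within `m` steps,
then `π` can be composed with a permutation supported on `S` (the inverse of the first return map)
so that all cycles have length at most `m`. -/
lemma exists_perm_mul_orbitSize_le {α : Type*} [Finite α] (π : Equiv.Perm α) (S : Set α) (m : ℕ)
    (h : ∀ x, ∃ k, 0 < k ∧ k ≤ m ∧ ((π ^ k) x = x ∨ (π ^ k) x ∈ S)) :
    ∃ σ : Equiv.Perm α, (∀ x, x ∉ S → σ x = x) ∧ ∀ x, orbitSize (π * σ) x ≤ m := by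
  classical
  have hret : ∀ x, ∃ k, (x ∈ S → 0 < k ∧ k ≤ m ∧ (π ^ k) x ∈ S ∧
      ∀ j, 0 < j → j < k → (π ^ j) x ∉ S) ∧ (x ∉ S → k = 0) := by
    intro x
    by_cases hx : x ∈ S
    · have hex : ∃ k, 0 < k ∧ k ≤ m ∧ (π ^ k) x ∈ S := by
        obtain ⟨k, h0, hm, hk⟩ := h x
        exact ⟨k, h0, hm, hk.elim (fun e => e.symm ▸ hx) id⟩
      refine ⟨Nat.find hex, fun _ => ⟨(Nat.find_spec hex).1, (Nat.find_spec hex).2.1,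
        (Nat.find_spec hex).2.2, fun j h0 hj hS => ?_⟩, fun hn => absurd hx hn⟩
      exact Nat.find_min hex hj ⟨h0, hj.le.trans (Nat.find_spec hex).2.1, hS⟩
    · exact ⟨0, fun hn => absurd hn hx, fun _ => rfl⟩
  choose r hr hr0 using hret
  have hstep : ∀ x ∈ S, ∀ y ∈ S, r x ≤ r y → (π ^ r x) x = (π ^ r y) y → x = y := by
    intro x hx y hy hle he
    obtain ⟨d, hd⟩ := Nat.exists_eq_add_of_le hle
    rw [hd, pow_add, Equiv.Perm.mul_apply] at he
    have he' := (π ^ r x).injective he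
    rcases Nat.eq_zero_or_pos d with rfl | hdpos
    · simpa using he'
    · have hx0 := (hr x hx).1
      exact absurd (he' ▸ hx) ((hr y hy).2.2.2 d hdpos (by omega))
  have hfix : ∀ x, x ∉ S → (π ^ r x) x = x := fun x hx => by simp [hr0 x hx]
  have hinj : Function.Injective fun x => (π ^ r x) x := by
    intro x y hxy
    simp only at hxy
    by_cases hx : x ∈ S <;> by_cases hy : y ∈ S
    · rcases le_total (r x) (r y) with hle | hle
      · exact hstep x hx y hy hle hxy
      · exact (hstep y hy x hx hle hxy.symm).symm
    · rw [hfix y hy] at hxy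
      exact absurd (hxy ▸ (hr x hx).2.2.1) hy
    · rw [hfix x hx] at hxy
      exact absurd (hxy ▸ (hr y hy).2.2.1) hx
    · rwa [hfix x hx, hfix y hy] at hxy
  let f : Equiv.Perm α := Equiv.ofBijective _ (Finite.injective_iff_bijective.mp hinj)
  have hf : ∀ x, f x = (π ^ r x) x := fun x => rfl
  have hsupp : ∀ x, x ∉ S → f⁻¹ x = x := fun x hx => by
    rw [Equiv.Perm.inv_eq_iff_eq, hf, hfix x hx]
  have hpowsucc : ∀ (τ : Equiv.Perm α) (i : ℕ) (z : α), (τ ^ (i + 1)) z = τ ((τ ^ i) z) :=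
    fun τ i z => by rw [pow_succ', Equiv.Perm.mul_apply]
  have hS : ∀ s ∈ S, orbitSize (π * f⁻¹) s ≤ m := by
    intro s hs
    obtain ⟨y, rfl⟩ := f.surjective s
    have hy : y ∈ S := by
      by_contra hy
      rw [hf, hfix y hy] at hs
      exact hy hs
    obtain ⟨h0, hm, -, hmin⟩ := hr y hy
    have hpow : ∀ i, i + 1 ≤ r y → ((π * f⁻¹) ^ (i + 1)) (f y) = (π ^ (i + 1)) y := by
      intro i
      induction i with
      | zero => intro _; simp
      | succ i ih =>
        intro hi
        rw [hpowsucc, ih (by omega), Equiv.Perm.mul_apply,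
          hsupp _ (hmin (i + 1) (by omega) (by omega)), ← hpowsucc]
    refine (orbitSize_le_of_pow_apply_eq h0 ?_).trans hm
    obtain ⟨i, hi⟩ := Nat.exists_eq_add_of_lt h0
    have := hpow i (by omega)
    rw [show r y = i + 1 by omega, this, hf, show r y = i + 1 by omega]
  refine ⟨f⁻¹, hsupp, fun x => ?_⟩
  by_cases hmeet : ∃ k, k ≤ m ∧ ((π * f⁻¹) ^ k) x ∈ S
  · obtain ⟨k, -, hk⟩ := hmeet
    rw [orbitSize_eq_of_sameCycle (y := ((π * f⁻¹) ^ k) x) ⟨k, by simp⟩]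
    exact hS _ hk
  · push Not at hmeet
    have hpow : ∀ i, i ≤ m → ((π * f⁻¹) ^ i) x = (π ^ i) x := by
      intro i
      induction i with
      | zero => intro _; simp
      | succ i ih =>
        intro hi
        have hi' := hmeet i (by omega)
        rw [hpowsucc, Equiv.Perm.mul_apply, hsupp _ hi', ih (by omega), ← hpowsucc]
    obtain ⟨k, h0, hm, hk | hk⟩ := h x
    · exact (orbitSize_le_of_pow_apply_eq h0 ((hpow k hm).trans hk)).trans hm
    · exact absurd (hpow k hm ▸ hk) (hmeet k hm)

/-- There are at most `t` blocks of size at least `b` such that any set meeting all of them meets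
each trajectory of `π` that is not periodic within `m` steps. -/
lemma exists_blocks {α : Type*} [Fintype α] [DecidableEq α] (π : Equiv.Perm α) {m b t : ℕ}
    (hb : 0 < b) (hbm : 3 * b ≤ m + 2) (hbn : b ≤ Fintype.card α)
    (ht : ∀ k, k * b ≤ Fintype.card α → k ≤ t) :
    ∃ A : Fin t → Finset α, (∀ i, b ≤ (A i).card) ∧
      ∀ S : Set α, (∀ i, ∃ y ∈ A i, y ∈ S) →
        ∀ x, ∃ k, 0 < k ∧ k ≤ m ∧ ((π ^ k) x = x ∨ (π ^ k) x ∈ S) := by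
  let W : α → Finset α := fun x => (Finset.Icc 1 b).image fun i => (π ^ i) x
  let P : Finset α → Prop := fun T =>
    (∀ x ∈ T, (W x).card = b) ∧ (T : Set α).PairwiseDisjoint W
  obtain ⟨T, hT, hmax⟩ : ∃ T, P T ∧ ∀ T', P T' → T'.card ≤ T.card := by
    classical
    have hne : (Finset.univ.filter P).Nonempty := ⟨∅, by simp [P]⟩
    obtain ⟨T, hT, hmax⟩ := Finset.exists_max_image _ Finset.card hne
    exact ⟨T, (Finset.mem_filter.mp hT).2, fun T' h => hmax T' (by simp [h])⟩
  have hcard : T.card ≤ t := by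
    apply ht
    rw [← Finset.sum_const_nat hT.1, ← Finset.card_biUnion hT.2]
    exact Finset.card_le_univ _
  refine ⟨fun i => if h : (i : ℕ) < T.card then W (T.equivFin.symm ⟨i, h⟩) else Finset.univ,
    fun i => ?_, fun S hS x => ?_⟩
  · dsimp only
    split_ifs with h
    · exact (hT.1 _ (Subtype.coe_prop _)).ge
    · exact hbn
  have hS' : ∀ y ∈ T, ∃ z ∈ W y, z ∈ S := by
    intro y hy
    have hlt := (T.equivFin ⟨y, hy⟩).isLt
    have := hS ⟨T.equivFin ⟨y, hy⟩, hlt.trans_le hcard⟩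
    simpa [hlt] using this
  by_cases hper : ∃ k, 0 < k ∧ k ≤ m ∧ (π ^ k) x = x
  · obtain ⟨k, h0, hm, hk⟩ := hper
    exact ⟨k, h0, hm, Or.inl hk⟩
  set x' := (π ^ (b - 1)) x with hx'
  have hW : (W x').card = b := by
    rw [Finset.card_image_of_injOn, Nat.card_Icc, Nat.add_sub_cancel]
    have key : ∀ i ∈ Set.Icc 1 b, ∀ j ∈ Set.Icc 1 b, i < j → (π ^ i) x' ≠ (π ^ j) x' := by
      intro i hi j hj hij he
      refine hper ⟨j - i, by omega, by have := hj.2; omega, ?_⟩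
      rw [hx', ← Equiv.Perm.mul_apply, ← Equiv.Perm.mul_apply, ← pow_add, ← pow_add,
        show j + (b - 1) = (i + (b - 1)) + (j - i) by omega, pow_add _ _ (j - i),
        Equiv.Perm.mul_apply] at he
      exact ((π ^ (i + (b - 1))).injective he).symm
    intro i hi j hj he
    simp only [Finset.coe_Icc] at hi hj
    rcases lt_trichotomy i j with hij | hij | hij
    · exact absurd he (key i hi j hj hij)
    · exact hij
    · exact absurd he.symm (key j hj i hi hij)
  obtain ⟨y, hy, hdis⟩ : ∃ y ∈ T, ¬ Disjoint (W x') (W y) := by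
    by_contra! hall
    have hnot : x' ∉ T := fun hmem => by
      have := hall x' hmem
      rw [disjoint_self, Finset.bot_eq_empty, ← Finset.card_eq_zero] at this
      omega
    have := hmax (insert x' T) ⟨?_, ?_⟩
    · rw [Finset.card_insert_of_notMem hnot] at this
      omega
    · intro z hz
      rcases Finset.mem_insert.mp hz with rfl | hz
      · exact hW
      · exact hT.1 z hz
    · rw [Finset.coe_insert]
      exact hT.2.insert fun z hz _ => hall z hz
  obtain ⟨w, hw1, hw2⟩ := Finset.not_disjoint_iff.mp hdis
  obtain ⟨i, hi, rfl⟩ := Finset.mem_image.mp hw1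
  obtain ⟨j, hj, hij⟩ := Finset.mem_image.mp hw2
  obtain ⟨z, hz, hzS⟩ := hS' y hy
  obtain ⟨l, hl, rfl⟩ := Finset.mem_image.mp hz
  simp only [Finset.mem_Icc] at hi hj hl
  have hyx : y = (π ^ (i + (b - 1) - j)) x := by
    rw [hx', ← Equiv.Perm.mul_apply, ← pow_add,
      show i + (b - 1) = j + (i + (b - 1) - j) by omega, pow_add, Equiv.Perm.mul_apply] at hij
    exact (π ^ j).injective hij
  refine ⟨l + (i + (b - 1) - j), by omega, by omega, Or.inr ?_⟩
  rw [pow_add, Equiv.Perm.mul_apply, ← hyx]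
  exact hzS

/-- A union bound: if there are few sets, each of density at least `p`, then some `N` points
meet all of them. -/
lemma exists_hitting_family {X ι : Type*} [Fintype X] [DecidableEq X] [Nonempty X] [Fintype ι]
    (G : ι → Finset X) (p : ℝ) (N : ℕ)
    (hp : ∀ i, p * Fintype.card X ≤ (G i).card)
    (hN : (Fintype.card ι : ℝ) < Real.exp (p * N)) :
    ∃ Z : Finset X, Z.card ≤ N ∧ ∀ i, ∃ x ∈ Z, x ∈ G i := by
  classical
  let B : ι → Finset (Fin N → X) := fun i => Fintype.piFinset fun _ => (G i)ᶜ
  have hX : (0 : ℝ) < Fintype.card X := by exact_mod_cast Fintype.card_pos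
  have hB : ∀ i, ((B i).card : ℝ) ≤ (Real.exp (-(p * N))) * (Fintype.card X : ℝ) ^ N := by
    intro i
    have h1 : ((G i)ᶜ.card : ℝ) ≤ Real.exp (-p) * Fintype.card X := by
      rw [Finset.card_compl, Nat.cast_sub (Finset.card_le_univ _)]
      have := Real.add_one_le_exp (-p)
      nlinarith [hp i]
    calc ((B i).card : ℝ) = ((G i)ᶜ.card : ℝ) ^ N := by simp [B]
      _ ≤ (Real.exp (-p) * Fintype.card X) ^ N := by gcongr
      _ = _ := by rw [mul_pow, ← Real.exp_nat_mul]; ring_nf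
  have hlt : ((Finset.univ.biUnion B).card : ℝ) < Fintype.card (Fin N → X) := by
    calc ((Finset.univ.biUnion B).card : ℝ) ≤ ∑ i, ((B i).card : ℝ) := by
          exact_mod_cast Finset.card_biUnion_le
      _ ≤ ∑ _i : ι, Real.exp (-(p * N)) * (Fintype.card X : ℝ) ^ N :=
          Finset.sum_le_sum fun i _ => hB i
      _ = (Fintype.card ι * Real.exp (-(p * N))) * (Fintype.card X : ℝ) ^ N := by
          simp [mul_assoc]
      _ < 1 * (Fintype.card X : ℝ) ^ N := by
          gcongr
          rwa [Real.exp_neg, ← div_eq_mul_inv, div_lt_one (Real.exp_pos _)]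
      _ = _ := by simp
  obtain ⟨g, hg⟩ : ∃ g, g ∉ Finset.univ.biUnion B := by
    by_contra! hall
    rw [Finset.eq_univ_iff_forall.mpr hall, Finset.card_univ] at hlt
    exact lt_irrefl _ hlt
  refine ⟨Finset.univ.image g, Finset.card_image_le.trans (by simp), fun i => ?_⟩
  have hgi : ∃ j, g j ∈ G i := by
    by_contra! hall
    exact hg (Finset.mem_biUnion.mpr ⟨i, Finset.mem_univ _, by simpa [B] using hall⟩)
  obtain ⟨j, hj⟩ := hgi
  exact ⟨g j, by simp, hj⟩

lemma card_perm_fixing_compl_range_le {α : Type*} [Fintype α] [DecidableEq α] {t : ℕ}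
    (x : Fin t → α) :
    (Finset.univ.filter fun σ : Equiv.Perm α =>
      ∀ a, a ∉ Set.range x → σ a = a).card ≤ t.factorial := by
  classical
  rw [← Fintype.card_subtype,
    ← Fintype.card_congr (Equiv.Perm.subtypeEquivSubtypePerm fun a => a ∈ Set.range x),
    Fintype.card_perm]
  refine Nat.factorial_le ?_
  rw [← Nat.card_eq_fintype_card]
  exact (Finite.card_range_le x).trans (by simp)

lemma six_mul_rpow_le {u : ℝ} (hu : 1 ≤ u) :
    12 * u * ((6 * u) ^ (6 * u) * (6 * u) ^ (6 * u)) ≤ (4 * u) ^ (16 * u + 4) := by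
  have h6 : 0 < 6 * u := by linarith
  have h4 : 0 < 4 * u := by linarith
  have hsq : 0 ≤ u ^ 3 * (u - 1) := mul_nonneg (by positivity) (by linarith)
  have hcube : 1 ≤ u ^ 3 := one_le_pow₀ hu
  have h1 : (6 * u) ^ (6 * u) * (6 * u) ^ (6 * u) ≤ (4 * u) ^ (16 * u) := by
    rw [← Real.rpow_add h6, show 6 * u + 6 * u = (3 : ℕ) * (4 * u) by push_cast; ring,
      show 16 * u = (4 : ℕ) * (4 * u) by push_cast; ring, Real.rpow_mul h6.le,
      Real.rpow_mul h4.le, Real.rpow_natCast, Real.rpow_natCast]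
    gcongr
    nlinarith
  have h2 : 12 * u ≤ (4 * u) ^ (4 : ℝ) := by
    rw [show (4 : ℝ) = (4 : ℕ) by norm_num, Real.rpow_natCast]
    push_cast
    nlinarith
  rw [Real.rpow_add h4, mul_comm ((4 * u) ^ (16 * u))]
  gcongr

/-- There is a constant `C > 0` such that for every positive integer `n` and
every real `1 ≤ u ≤ n` there is a set `F` of at most `C · n · (4u)^(16u+4)`
permutations of `Fin n` such that every permutation `π` of `Fin n` can be
composed with some `σ ∈ F` so that every cycle of `π ∘ σ` has length at most
`n/u`. -/
theorem exists_cycle_breaking_family :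
    ∃ C : ℝ, 0 < C ∧
      ∀ n : ℕ, 0 < n → ∀ u : ℝ, 1 ≤ u → u ≤ (n : ℝ) →
        ∃ F : Finset (Equiv.Perm (Fin n)),
          (F.card : ℝ) ≤ C * (n : ℝ) * (4 * u) ^ (16 * u + 4) ∧
          ∀ π : Equiv.Perm (Fin n),
            ∃ σ ∈ F, ∀ x, (orbitSize (π * σ) x : ℝ) ≤ (n : ℝ) / u := by
  refine ⟨1, one_pos, fun n hn u hu hun => ?_⟩
  have hu0 : 0 < u := by linarith
  have hn1 : (1 : ℝ) ≤ n := by exact_mod_cast hn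
  have : NeZero n := ⟨hn.ne'⟩
  set m := ⌊(n : ℝ) / u⌋₊ with hm
  have hmle : (m : ℝ) ≤ n / u := Nat.floor_le (by positivity)
  have hm1 : 1 ≤ m := Nat.le_floor (by rw [Nat.cast_one, one_le_div hu0]; exact hun)
  have hmlt : (n : ℝ) / u < m + 1 := Nat.lt_floor_add_one _
  obtain ⟨b, hb, hbm, hmb⟩ : ∃ b, 0 < b ∧ 3 * b ≤ m + 2 ∧ m ≤ 3 * b :=
    ⟨(m + 2) / 3, by omega, by omega, by omega⟩
  have hb0 : (0 : ℝ) < b := by exact_mod_cast hb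
  have hmn : m ≤ n := by
    have : (m : ℝ) ≤ n := hmle.trans (div_le_self (by positivity) hu)
    exact_mod_cast this
  have hnb : (n : ℝ) ≤ 6 * u * b := by
    have h1 : (n : ℝ) < (m + 1) * u := (div_lt_iff₀ hu0).mp hmlt
    have h2 : (m : ℝ) + 1 ≤ 6 * b := by
      have : m + 1 ≤ 6 * b := by omega
      exact_mod_cast this
    nlinarith
  set t := ⌊6 * u⌋₊ with htdef
  have ht6 : (t : ℝ) ≤ 6 * u := Nat.floor_le (by positivity)
  have ht1 : 1 ≤ t := Nat.le_floor (by push_cast; linarith)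
  have htb : ∀ k, k * b ≤ Fintype.card (Fin n) → k ≤ t := by
    intro k hk
    rw [Fintype.card_fin] at hk
    refine Nat.le_floor (le_of_mul_le_mul_right (le_trans ?_ hnb) hb0)
    exact_mod_cast hk
  have hpow : ∀ v : ℝ, 0 ≤ v → v ≤ 6 * u → v ^ t ≤ (6 * u) ^ (6 * u) := by
    intro v hv hvu
    calc v ^ t ≤ (6 * u) ^ t := by gcongr
      _ = (6 * u) ^ (t : ℝ) := (Real.rpow_natCast _ _).symm
      _ ≤ _ := Real.rpow_le_rpow_of_exponent_le (by linarith) ht6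
  let ι := {A : Fin t → Finset (Fin n) // ∀ i, b ≤ (A i).card}
  let G : ι → Finset (Fin t → Fin n) := fun A => Fintype.piFinset A.1
  set p : ℝ := ((b : ℝ) / n) ^ t with hp
  have hp0 : 0 < p := by positivity
  set N := ⌈(n : ℝ) * t / p⌉₊ with hNdef
  have hNle : (N : ℝ) ≤ 12 * u * n * (6 * u) ^ (6 * u) := by
    have h1 : (N : ℝ) < n * t / p + 1 := Nat.ceil_lt_add_one (by positivity)
    have h2 : p⁻¹ ≤ (6 * u) ^ (6 * u) := by
      rw [hp, ← inv_pow, inv_div]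
      exact hpow _ (by positivity) ((div_le_iff₀ hb0).mpr hnb)
    have h3 : (n : ℝ) * t / p ≤ n * (6 * u) * (6 * u) ^ (6 * u) := by
      rw [div_eq_mul_inv]
      gcongr
    have h4 : (1 : ℝ) ≤ (6 * u) ^ (6 * u) :=
      Real.one_le_rpow (by linarith) (by positivity)
    have h5 : 1 ≤ n * (6 * u) * (6 * u) ^ (6 * u) :=
      one_le_mul_of_one_le_of_one_le
        (one_le_mul_of_one_le_of_one_le hn1 (by linarith)) h4
    linarith
  obtain ⟨Z, hZN, hZ⟩ := exists_hitting_family G p N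
    (by
      intro A
      have h1 : b ^ t ≤ (G A).card := by
        rw [Fintype.card_piFinset]
        calc b ^ t = ∏ _i : Fin t, b := by simp
          _ ≤ _ := Finset.prod_le_prod' fun i _ => A.2 i
      have h2 : p * Fintype.card (Fin t → Fin n) = (b : ℝ) ^ t := by
        simp only [Fintype.card_pi, Fintype.card_fin, Finset.prod_const, Finset.card_univ]
        rw [hp, div_pow]
        push_cast
        field_simp
      rw [h2]
      exact_mod_cast h1)
    (by
      have h1 : (Fintype.card ι : ℝ) ≤ 2 ^ (n * t) := by
        have : Fintype.card ι ≤ Fintype.card (Fin t → Finset (Fin n)) :=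
          Fintype.card_subtype_le _
        rw [Fintype.card_fun, Fintype.card_finset, Fintype.card_fin, Fintype.card_fin,
          ← pow_mul] at this
        exact_mod_cast this
      have h2 : (n : ℝ) * t ≤ p * N := by
        rw [mul_comm p, ← div_le_iff₀ hp0]
        exact Nat.le_ceil _
      have h3 : (2 : ℝ) ^ (n * t) < Real.exp 1 ^ (n * t) :=
        pow_lt_pow_left₀ (by linarith [Real.exp_one_gt_d9]) (by norm_num)
          (Nat.mul_pos hn ht1).ne'
      calc (Fintype.card ι : ℝ) < Real.exp 1 ^ (n * t) := h1.trans_lt h3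
        _ = Real.exp (n * t) := by rw [← Real.exp_nat_mul]; push_cast; ring_nf
        _ ≤ _ := Real.exp_le_exp.mpr h2)
  refine ⟨Z.biUnion fun x => Finset.univ.filter fun σ : Equiv.Perm (Fin n) =>
    ∀ a, a ∉ Set.range x → σ a = a, ?_, fun π => ?_⟩
  · have h1 := Finset.card_biUnion_le_card_mul Z
      (fun x => Finset.univ.filter fun σ : Equiv.Perm (Fin n) => ∀ a, a ∉ Set.range x → σ a = a)
      t.factorial fun x _ => by convert card_perm_fixing_compl_range_le x
    have h2 : (t.factorial : ℝ) ≤ (6 * u) ^ (6 * u) := by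
      refine le_trans ?_ (hpow t (by positivity) ht6)
      exact_mod_cast Nat.factorial_le_pow t
    calc _ ≤ ((Z.card * t.factorial : ℕ) : ℝ) := by exact_mod_cast h1
      _ ≤ N * t.factorial := by
          push_cast
          gcongr
      _ ≤ (12 * u * n * (6 * u) ^ (6 * u)) * (6 * u) ^ (6 * u) := by gcongr
      _ = n * (12 * u * ((6 * u) ^ (6 * u) * (6 * u) ^ (6 * u))) := by ring
      _ ≤ n * (4 * u) ^ (16 * u + 4) := by
          gcongr
          exact six_mul_rpow_le hu
      _ = _ := by ring
  · obtain ⟨A, hA, hAS⟩ := exists_blocks π hb hbm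
      (by rw [Fintype.card_fin]; omega) htb
    obtain ⟨x, hxZ, hx⟩ := hZ ⟨A, hA⟩
    have hx' : ∀ i, x i ∈ A i := Fintype.mem_piFinset.mp hx
    obtain ⟨σ, hσ, hσm⟩ := exists_perm_mul_orbitSize_le π (Set.range x) m
      (hAS _ fun i => ⟨x i, hx' i, i, rfl⟩)
    refine ⟨σ, ?_, fun y => le_trans (by exact_mod_cast hσm y) hmle⟩
    exact Finset.mem_biUnion.mpr ⟨x, hxZ, by simpa using hσ⟩
end

section
/- There exist a function f : ℕ → ℝ with f(n) → 0 as n → ∞ and a threshold N such that for every n ≥ N the following holds. Set r = ⌊n/ln n⌋. For a permutation π of Fin n (thought of as: drawer j contains number π(j)), let s(π) : Fin r → Fin n be the restriction of π to the first r positions; let A(π) be the set of the n−r values not appearing among the first r drawers; let π₁(π) be the permutation of Fin(n−r) obtained from the restriction of π to positions r, …, n−1 (which is a bijection onto A(π)) by identifying positions r, …, n−1 with Fin(n−r) in increasing order and identifying A(π) with Fin(n−r) via the order-preserving bijection. Then there exists a function B mapping each possible first-r-contents tuple (each injection Fin r ↪ Fin n) to a permutation of Fin(n−r) such that: for every π ∈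 Perm(Fin n) there exist positions j₀ ∈ Fin r and j₁ ∈ Fin n such that, with π′ := π ∘ swap(j₀, j₁), every cycle of the composition π₁(π′) ∘ B(s(π′)) has length at most (n · ln ln n / ln n) · (1 + f(n)). -/
/-- The contents of the first `r` drawers: the restriction of `π` to the first
`r` positions, as an injection `Fin r ↪ Fin n`. -/
def firstContents (n r : ℕ) (h : r ≤ n) (π : Equiv.Perm (Fin n)) : Fin r ↪ Fin n :=
  (Fin.castLEEmb h).trans π.toEmbedding

/-- `A(π)`: the set of values not appearing among the first `r` drawers. -/
def restValues (n r : ℕ) (h : r ≤ n) (π : Equiv.Perm (Fin n)) : Finset (Fin n) :=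
  (Finset.univ.map (firstContents n r h π))ᶜ

lemma restValues_card (n r : ℕ) (h : r ≤ n) (π : Equiv.Perm (Fin n)) :
    (restValues n r h π).card = n - r := by
  simp [restValues, Finset.card_compl]

lemma mem_restValues (n r : ℕ) (h : r ≤ n) (π : Equiv.Perm (Fin n)) (i : Fin (n - r)) :
    π ⟨r + i.val, by have := i.isLt; omega⟩ ∈ restValues n r h π := by
  simp only [restValues, Finset.mem_compl, Finset.mem_map, Finset.mem_univ, true_and,
    not_exists]
  intro j hj
  have h2 : (Fin.castLE h j) = (⟨r + i.val, by have := i.isLt; omega⟩ : Fin n) :=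
    π.injective (by simpa [firstContents] using hj)
  have h3 := congrArg Fin.val h2
  simp only [Fin.coe_castLE] at h3
  have := j.isLt
  omega

/-- `π₁(π)`: the permutation of `Fin (n - r)` obtained from the restriction of
`π` to positions `r, …, n−1` (a bijection onto `A(π)`), identifying positions
`r, …, n−1` with `Fin (n−r)` in increasing order and identifying `A(π)` with
`Fin (n−r)` via the order-preserving bijection. -/
noncomputable def pi1 (n r : ℕ) (h : r ≤ n) (π : Equiv.Perm (Fin n)) :
    Equiv.Perm (Fin (n - r)) :=
  Equiv.ofBijective
    (fun i => ((restValues n r h π).orderIsoOfFin (restValues_card n r h π)).symm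
        ⟨π ⟨r + i.val, by have := i.isLt; omega⟩, mem_restValues n r h π i⟩)
    (by
      have hinj : Function.Injective
          (fun i : Fin (n - r) =>
            ((restValues n r h π).orderIsoOfFin (restValues_card n r h π)).symm
              ⟨π ⟨r + i.val, by have := i.isLt; omega⟩, mem_restValues n r h π i⟩) := by
        intro i i' hii
        have h1 := ((restValues n r h π).orderIsoOfFin
          (restValues_card n r h π)).symm.injective hii
        have h2 : π ⟨r + i.val, by have := i.isLt; omega⟩
            = π ⟨r + i'.val, by have := i'.isLt; omega⟩ := congrArg Subtype.val h1
        have h3 := congrArg Fin.val (π.injective h2)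
        simp only at h3
        exact Fin.ext (by omega)
      exact Finite.injective_iff_bijective.mp hinj)

/-- `r(n) = ⌊n / ln n⌋`. -/
noncomputable def rOf (n : ℕ) : ℕ := ⌊(n : ℝ) / Real.log n⌋₊

/-- Every point returns to itself under `σ` after at most `L` (and at least one) steps. -/
def HasShortCycles {α : Type*} (L : ℕ) (σ : Equiv.Perm α) : Prop :=
  ∀ x, ∃ k, 0 < k ∧ k ≤ L ∧ (⇑σ)^[k] x = x

lemma HasShortCycles.orbitSize_le {α : Type*} [Finite α] {L : ℕ} {σ : Equiv.Perm α}
    (h : HasShortCycles L σ) (x : α) : orbitSize σ x ≤ L := by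
  classical
  obtain ⟨k, hk0, hkL, hk⟩ := h x
  have hsub : {z | σ.SameCycle x z} ⊆
      ((Finset.range k).image fun i => (⇑σ)^[i] x : Finset α) := by
    rintro z hz
    obtain ⟨i, -, hi⟩ := Equiv.Perm.SameCycle.exists_pow_eq' hz
    have hp : Function.IsPeriodicPt σ k x := hk
    simp only [Finset.coe_image, Set.mem_image, Finset.coe_range, Set.mem_Iio]
    refine ⟨i % k, Nat.mod_lt _ hk0, ?_⟩
    rw [hp.iterate_mod_apply, ← hi, Equiv.Perm.iterate_eq_pow]
  calc orbitSize σ x ≤ _ := Set.ncard_le_ncard hsub (Finset.finite_toSet _)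
    _ ≤ k := by
      rw [Set.ncard_coe_finset]
      exact Finset.card_image_le.trans (by simp)
    _ ≤ L := hkL

lemma hasShortCycles_of_card_le {α : Type*} [Fintype α] {L : ℕ} (h : Fintype.card α ≤ L)
    (σ : Equiv.Perm α) : HasShortCycles L σ := by
  intro x
  have hx : x ∈ Function.periodicPts σ :=
    (Function.Injective.mem_periodicPts σ.injective x)
  exact ⟨_, Function.minimalPeriod_pos_of_mem_periodicPts hx,
    Function.minimalPeriod_le_card.trans h, Function.iterate_minimalPeriod⟩

section insertCycle

variable {α : Type*} {d : ℕ}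

open Classical in
/-- The permutation which cyclically permutes the points listed by `e` and acts as `τ` on the
other points. -/
noncomputable def insertCycle (e : Fin (d + 1) ↪ α)
    (τ : Equiv.Perm {y // ¬ y ∈ Set.range e}) : Equiv.Perm α :=
  Equiv.Perm.subtypeCongr
    ((Equiv.ofInjective e e.injective).permCongr (finRotate (d + 1))) τ

lemma insertCycle_apply_emb (e : Fin (d + 1) ↪ α)
    (τ : Equiv.Perm {y // ¬ y ∈ Set.range e}) (i : Fin (d + 1)) :
    insertCycle e τ (e i) = e (i + 1) := by
  classical
  unfold insertCycle
  rw [Equiv.Perm.subtypeCongr.left_apply _ _ (Set.mem_range_self i)]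
  have : (⟨e i, Set.mem_range_self i⟩ : Set.range e) = Equiv.ofInjective e e.injective i := rfl
  rw [Equiv.permCongr_apply, this, Equiv.symm_apply_apply, finRotate_apply]
  rfl

lemma insertCycle_apply_rest (e : Fin (d + 1) ↪ α)
    (τ : Equiv.Perm {y // ¬ y ∈ Set.range e}) (y : {y // ¬ y ∈ Set.range e}) :
    insertCycle e τ y = τ y := by
  classical
  exact Equiv.Perm.subtypeCongr.right_apply_subtype _ _ y

lemma insertCycle_iterate_emb (e : Fin (d + 1) ↪ α)
    (τ : Equiv.Perm {y // ¬ y ∈ Set.range e}) (i : Fin (d + 1)) (k : ℕ) :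
    (insertCycle e τ)^[k] (e i) = e (i + Fin.ofNat (d + 1) k) := by
  induction k with
  | zero => simp
  | succ k ih =>
    have hk : Fin.ofNat (d + 1) (k + 1) = Fin.ofNat (d + 1) k + 1 := by
      ext
      simp [Fin.val_add]
    rw [Function.iterate_succ_apply', ih, insertCycle_apply_emb, hk, add_assoc]

lemma insertCycle_iterate_rest (e : Fin (d + 1) ↪ α)
    (τ : Equiv.Perm {y // ¬ y ∈ Set.range e}) (y : {y // ¬ y ∈ Set.range e}) (k : ℕ) :
    (insertCycle e τ)^[k] y = (τ^[k] y : {y // ¬ y ∈ Set.range e}) := by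
  induction k with
  | zero => simp
  | succ k ih =>
    rw [Function.iterate_succ_apply', ih, insertCycle_apply_rest, Function.iterate_succ_apply']

lemma minimalPeriod_insertCycle (e : Fin (d + 1) ↪ α)
    (τ : Equiv.Perm {y // ¬ y ∈ Set.range e}) :
    Function.minimalPeriod (insertCycle e τ) (e 0) = d + 1 := by
  have hiff : ∀ k, Function.IsPeriodicPt (insertCycle e τ) k (e 0) ↔ d + 1 ∣ k := by
    intro k
    unfold Function.IsPeriodicPt Function.IsFixedPt
    rw [insertCycle_iterate_emb, e.injective.eq_iff, zero_add, Fin.ext_iff, Fin.val_ofNat, Fin.val_zero,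
      Nat.dvd_iff_mod_eq_zero]
  refine Nat.dvd_antisymm ?_ ?_
  · exact Function.IsPeriodicPt.minimalPeriod_dvd ((hiff _).2 dvd_rfl)
  · exact (hiff _).1 (Function.isPeriodicPt_minimalPeriod _ _)

lemma HasShortCycles.insertCycle {L : ℕ} (hd : d + 1 ≤ L) (e : Fin (d + 1) ↪ α)
    {τ : Equiv.Perm {y // ¬ y ∈ Set.range e}} (hτ : HasShortCycles L τ) :
    HasShortCycles L (insertCycle e τ) := by
  intro x
  by_cases hx : x ∈ Set.range e
  · obtain ⟨i, rfl⟩ := hx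
    refine ⟨d + 1, d.succ_pos, hd, ?_⟩
    have h0 : Fin.ofNat (d + 1) (d + 1) = 0 := by
      ext
      simp
    rw [insertCycle_iterate_emb, h0, add_zero]
  · obtain ⟨k, hk0, hkL, hk⟩ := hτ ⟨x, hx⟩
    refine ⟨k, hk0, hkL, ?_⟩
    have := insertCycle_iterate_rest e τ ⟨x, hx⟩ k
    rw [hk] at this
    exact this

lemma insertCycle_inj {e e' : Fin (d + 1) ↪ α}
    {τ : Equiv.Perm {y // ¬ y ∈ Set.range e}} {τ' : Equiv.Perm {y // ¬ y ∈ Set.range e'}}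
    (h : insertCycle e τ = insertCycle e' τ') (h0 : e 0 = e' 0) : e = e' ∧ HEq τ τ' := by
  have he : e = e' := by
    refine DFunLike.ext _ _ fun i => ?_
    have h1 := insertCycle_iterate_emb e τ 0 i
    have h2 := insertCycle_iterate_emb e' τ' 0 i
    rw [zero_add, Fin.ofNat_val_eq_self] at h1 h2
    rw [← h1, ← h2, h, h0]
  subst he
  refine ⟨rfl, heq_of_eq ?_⟩
  ext y
  rw [← insertCycle_apply_rest, ← insertCycle_apply_rest, h]

end insertCycle

lemma sum_card_shortCycles_le {α : Type*} [Fintype α] {b w L : ℕ} (hL : b + w ≤ L) :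
    ∑ i : Fin w, ∑ e : Fin (b + i + 1) ↪ α,
      Nat.card {τ : Equiv.Perm {y // ¬ y ∈ Set.range e} // HasShortCycles L τ} ≤
    Nat.card {σ : Equiv.Perm α // HasShortCycles L σ} * Fintype.card α := by
  classical
  let F : (Σ i : Fin w, Σ e : Fin (b + i + 1) ↪ α,
      {τ : Equiv.Perm {y // ¬ y ∈ Set.range e} // HasShortCycles L τ}) →
      {σ : Equiv.Perm α // HasShortCycles L σ} × α :=
    fun t => (⟨insertCycle t.2.1 t.2.2.1,
      t.2.2.2.insertCycle (by have := t.1.isLt; omega) t.2.1⟩, t.2.1 0)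
  have hF : Function.Injective F := by
    rintro ⟨i, e, τ, hτ⟩ ⟨i', e', τ', hτ'⟩ h
    have h1 : insertCycle e τ = insertCycle e' τ' := congrArg (fun z => z.1.1) h
    have h2 : e 0 = e' 0 := congrArg (fun z => z.2) h
    have hi : i = i' := by
      have h3 := minimalPeriod_insertCycle e τ
      rw [h1, h2, minimalPeriod_insertCycle e' τ'] at h3
      ext
      omega
    subst hi
    obtain ⟨rfl, h4⟩ := insertCycle_inj h1 h2
    obtain rfl := eq_of_heq h4
    rfl
  have := Nat.card_le_card_of_injective F hF
  rwa [Nat.card_prod, Nat.card_eq_fintype_card (α := α), Nat.card_sigma,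
    Finset.sum_congr rfl fun i _ => Nat.card_sigma] at this

/-- A lower bound for the proportion of permutations without long cycles. -/
lemma pow_mul_factorial_le_card_shortCycles {b w L M : ℕ} (hL : b + w ≤ L) {q : ℝ} (hq0 : 0 ≤ q)
    (hq1 : q ≤ 1) (hq : q * M ≤ w) (k : ℕ) (α : Type) [Fintype α]
    (hk : Fintype.card α ≤ b * k + L) (hM : Fintype.card α ≤ M) :
    q ^ k * (Fintype.card α).factorial ≤
      Nat.card {σ : Equiv.Perm α // HasShortCycles L σ} := by
  classical
  have small : ∀ (β : Type) [Fintype β] (k : ℕ), Fintype.card β ≤ L →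
      q ^ k * (Fintype.card β).factorial ≤
        Nat.card {σ : Equiv.Perm β // HasShortCycles L σ} := by
    intro β _ k h
    rw [Nat.card_congr (Equiv.subtypeUnivEquiv (hasShortCycles_of_card_le h)),
      Nat.card_eq_fintype_card, Fintype.card_perm]
    exact mul_le_of_le_one_left (by positivity) (pow_le_one₀ hq0 hq1)
  induction k generalizing α with
  | zero => exact small α 0 (by simpa using hk)
  | succ k ih =>
    by_cases h : Fintype.card α ≤ L
    · exact small α _ h
    have hterm : ∀ (i : Fin w) (e : Fin (b + i + 1) ↪ α),
        q ^ k * (Fintype.card α - (b + i + 1)).factorial ≤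
          (Nat.card {τ : Equiv.Perm {y // ¬ y ∈ Set.range e} // HasShortCycles L τ} : ℝ) := by
      intro i e
      have hc : Fintype.card {y // ¬ y ∈ Set.range e} = Fintype.card α - (b + i + 1) := by
        rw [Fintype.card_subtype_compl]
        congr 1
        rw [← Fintype.card_congr (Equiv.ofInjective e e.injective), Fintype.card_fin]
      have := i.isLt
      rw [mul_add, mul_one] at hk
      rw [← hc]
      have hle : Fintype.card {y // ¬ y ∈ Set.range e} ≤ b * k + L := by omega
      exact ih _ hle (by omega)
    have hsum : (w : ℝ) * (q ^ k * (Fintype.card α).factorial) ≤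
        Nat.card {σ : Equiv.Perm α // HasShortCycles L σ} * Fintype.card α := by
      calc (w : ℝ) * (q ^ k * (Fintype.card α).factorial)
          = ∑ i : Fin w, ∑ e : Fin (b + i + 1) ↪ α,
              q ^ k * (Fintype.card α - (b + i + 1)).factorial := by
            have : ∀ i : Fin w, ∑ e : Fin (b + i + 1) ↪ α,
                q ^ k * ((Fintype.card α - (b + i + 1)).factorial : ℝ) =
                q ^ k * (Fintype.card α).factorial := by
              intro i
              have := i.isLt
              rw [Finset.sum_const, Finset.card_univ, Fintype.card_embedding_eq, Fintype.card_fin,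
                ← Nat.factorial_mul_descFactorial (show b + i + 1 ≤ Fintype.card α by omega)]
              push_cast
              rw [nsmul_eq_mul]
              ring
            rw [Finset.sum_congr rfl fun i _ => this i]
            simp
        _ ≤ ∑ i : Fin w, ∑ e : Fin (b + i + 1) ↪ α,
              (Nat.card {τ : Equiv.Perm {y // ¬ y ∈ Set.range e} // HasShortCycles L τ} : ℝ) :=
            Finset.sum_le_sum fun i _ => Finset.sum_le_sum fun e _ => hterm i e
        _ ≤ _ := by exact_mod_cast sum_card_shortCycles_le (α := α) hL
    have hpos : (0 : ℝ) < Fintype.card α := by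
      have : 0 < Fintype.card α := by omega
      exact_mod_cast this
    refine le_of_mul_le_mul_right (le_trans ?_ hsum) hpos
    have hqm : q * Fintype.card α ≤ w :=
      (mul_le_mul_of_nonneg_left (by exact_mod_cast hM) hq0).trans hq
    calc q ^ (k + 1) * (Fintype.card α).factorial * Fintype.card α
        = (q * Fintype.card α) * (q ^ k * (Fintype.card α).factorial) := by ring
      _ ≤ _ := mul_le_mul_of_nonneg_right hqm (by positivity)

/-- First-moment bound: if each player `p` has `card K` independent chances, the `k`-th failing for
at most `c` of the values of `B (g p k)`, then some `B` gives every player a success. -/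
lemma exists_forall_exists_not_mem {P K I G : Type*} [Fintype P] [Fintype K] [Fintype I]
    [Fintype G] [Nonempty P] [Nonempty G] (g : P → K → I) (hg : ∀ p, Function.Injective (g p)) (T : P → K → Set G) (c : ℕ)
    (hT : ∀ p k, Nat.card (T p k) ≤ c)
    (h : Fintype.card P * c ^ Fintype.card K < Fintype.card G ^ Fintype.card K) :
    ∃ B : I → G, ∀ p, ∃ k, B (g p k) ∉ T p k := by
  classical
  by_contra! hcon
  obtain ⟨p₀⟩ := ‹Nonempty P›
  have hKI : Fintype.card K ≤ Fintype.card I := Fintype.card_le_of_injective _ (hg p₀)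
  let bad : P → Finset (I → G) := fun p => Finset.univ.filter fun B => ∀ k, B (g p k) ∈ T p k
  have hbad : ∀ p, (bad p).card ≤
      c ^ Fintype.card K * Fintype.card G ^ (Fintype.card I - Fintype.card K) := by
    intro p
    let F : {B : I → G // ∀ k, B (g p k) ∈ T p k} →
        (∀ k, T p k) × ({i // ¬ i ∈ Set.range (g p)} → G) :=
      fun B => (fun k => ⟨B.1 (g p k), B.2 k⟩, fun i => B.1 i)
    have hF : Function.Injective F := by
      rintro ⟨B, hB⟩ ⟨B', hB'⟩ hBB
      have h1 := congrArg Prod.fst hBB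
      have h2 := congrArg Prod.snd hBB
      ext i
      by_cases hi : i ∈ Set.range (g p)
      · obtain ⟨k, rfl⟩ := hi
        exact congrArg Subtype.val (congrFun h1 k)
      · exact congrFun h2 ⟨i, hi⟩
    have hc : Fintype.card {i // ¬ i ∈ Set.range (g p)} = Fintype.card I - Fintype.card K := by
      rw [Fintype.card_subtype_compl]
      congr 1
      rw [← Fintype.card_congr (Equiv.ofInjective (g p) (hg p))]
    have := Nat.card_le_card_of_injective F hF
    rw [Nat.card_prod, Nat.card_pi, Nat.card_fun, Nat.card_eq_fintype_card (α := G),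
      Nat.card_eq_fintype_card (α := {i // ¬ i ∈ Set.range (g p)}), hc] at this
    have hbc : Nat.card {B : I → G // ∀ k, B (g p k) ∈ T p k} = (bad p).card := by
      rw [Nat.card_eq_fintype_card, Fintype.card_subtype]
    rw [hbc] at this
    refine this.trans (Nat.mul_le_mul_right _ ?_)
    calc ∏ k, Nat.card (T p k) ≤ ∏ _k : K, c := Finset.prod_le_prod' fun k _ => hT p k
      _ = c ^ Fintype.card K := by simp
  have huniv : (Finset.univ : Finset (I → G)) ⊆ Finset.univ.biUnion bad := by
    intro B _
    obtain ⟨p, hp⟩ := hcon B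
    exact Finset.mem_biUnion.2 ⟨p, Finset.mem_univ _, by simpa [bad] using hp⟩
  have h1 : Fintype.card G ^ Fintype.card I ≤ Fintype.card P *
      (c ^ Fintype.card K * Fintype.card G ^ (Fintype.card I - Fintype.card K)) := by
    calc Fintype.card G ^ Fintype.card I = (Finset.univ : Finset (I → G)).card := by simp
      _ ≤ (Finset.univ.biUnion bad).card := Finset.card_le_card huniv
      _ ≤ _ := Finset.card_biUnion_le_card_mul _ _ _ fun p _ => hbad p
  have hG : 0 < Fintype.card G ^ (Fintype.card I - Fintype.card K) :=
    pow_pos Fintype.card_pos _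
  rw [← Nat.sub_add_cancel hKI, pow_add, mul_comm, Nat.add_sub_cancel, ← mul_assoc] at h1
  exact absurd (Nat.le_of_mul_le_mul_right h1 hG) (not_le.2 h)

lemma firstContents_swap_injective (n r : ℕ) (h : r ≤ n) (π : Equiv.Perm (Fin n)) :
    Function.Injective fun j : Fin r × Fin (n - r) =>
      firstContents n r h (π * Equiv.swap (Fin.castLE h j.1)
        ⟨r + j.2.val, by have := j.2.isLt; omega⟩) := by
  rintro ⟨a, b⟩ ⟨a', b'⟩ hab
  have h1 := DFunLike.congr_fun hab a
  simp only [firstContents, Function.Embedding.trans_apply, Equiv.coe_toEmbedding,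
    Equiv.Perm.coe_mul, Function.comp_apply, Fin.castLEEmb_apply, Equiv.swap_apply_left,
    EmbeddingLike.apply_eq_iff_eq] at h1
  have ha := a.isLt
  by_cases haa : a = a'
  · subst haa
    rw [Equiv.swap_apply_left] at h1
    have := congrArg Fin.val h1
    simp only at this
    ext
    · rfl
    · simp only
      omega
  · exfalso
    rw [Equiv.swap_apply_of_ne_of_ne] at h1
    · have := congrArg Fin.val h1
      simp only [Fin.val_castLE] at this
      omega
    · exact fun hh => haa (Fin.castLE_injective h hh)
    · intro hh
      have := congrArg Fin.val hh
      simp only [Fin.val_castLE] at this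
      omega

lemma exists_book_of_factorial_lt (n r L : ℕ) (h : r ≤ n) (p : ℝ)
    (hp : p * (n - r).factorial ≤
      Nat.card {σ : Equiv.Perm (Fin (n - r)) // HasShortCycles L σ})
    (hlt : n * Real.log n < p * (r * (n - r : ℕ))) :
    ∃ B : (Fin r ↪ Fin n) → Equiv.Perm (Fin (n - r)), ∀ π : Equiv.Perm (Fin n),
      ∃ (j₀ : Fin r) (j₁ : Fin n), ∀ x, orbitSize
        (pi1 n r h (π * Equiv.swap (Fin.castLE h j₀) j₁) *
          B (firstContents n r h (π * Equiv.swap (Fin.castLE h j₀) j₁))) x ≤ L := by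
  classical
  let σ' : Equiv.Perm (Fin n) → Fin r × Fin (n - r) → Equiv.Perm (Fin n) := fun π j =>
    π * Equiv.swap (Fin.castLE h j.1) ⟨r + j.2.val, by have := j.2.isLt; omega⟩
  set a := Nat.card {σ : Equiv.Perm (Fin (n - r)) // HasShortCycles L σ} with ha
  set c := Nat.card {σ : Equiv.Perm (Fin (n - r)) // ¬ HasShortCycles L σ} with hc
  have hac : a + c = (n - r).factorial := by
    rw [ha, hc, Nat.card_eq_fintype_card, Nat.card_eq_fintype_card, Fintype.card_subtype_compl,
      Fintype.card_perm, Fintype.card_fin]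
    have := Fintype.card_subtype_le fun σ : Equiv.Perm (Fin (n - r)) => HasShortCycles L σ
    rw [Fintype.card_perm, Fintype.card_fin] at this
    omega
  obtain ⟨B, hB⟩ := exists_forall_exists_not_mem
    (fun π j => firstContents n r h (σ' π j)) (fun π => firstContents_swap_injective n r h π)
    (fun π j => {β | ¬ HasShortCycles L (pi1 n r h (σ' π j) * β)}) c
    (by
      intro π j
      refine (Nat.card_congr ?_).le
      exact (Equiv.mulLeft (pi1 n r h (σ' π j))).subtypeEquiv fun β => Iff.rfl)
    (by
      rw [Fintype.card_perm, Fintype.card_perm, Fintype.card_prod, Fintype.card_fin,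
        Fintype.card_fin, Fintype.card_fin]
      have hm : (0 : ℝ) < (n - r).factorial := by positivity
      have hc1 : (c : ℝ) ≤ Real.exp (-p) * (n - r).factorial := by
        have h1 : (a : ℝ) + c = (n - r).factorial := by exact_mod_cast hac
        have h2 := mul_le_mul_of_nonneg_right (Real.one_sub_le_exp_neg p) hm.le
        linarith
      have hn : (n.factorial : ℝ) ≤ Real.exp (n * Real.log n) := by
        rcases Nat.eq_zero_or_pos n with rfl | hn
        · simp
        rw [mul_comm, Real.exp_mul, Real.exp_log (by exact_mod_cast hn), Real.rpow_natCast]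
        exact_mod_cast Nat.factorial_le_pow n
      have : (n.factorial : ℝ) * c ^ (r * (n - r)) <
          (n - r).factorial ^ (r * (n - r)) := by
        calc (n.factorial : ℝ) * c ^ (r * (n - r))
            ≤ Real.exp (n * Real.log n) * (Real.exp (-p) * (n - r).factorial) ^ (r * (n - r)) := by
              gcongr
          _ = Real.exp (n * Real.log n - p * (r * (n - r : ℕ))) *
                (n - r).factorial ^ (r * (n - r)) := by
              rw [mul_pow, ← Real.exp_nat_mul, ← mul_assoc, ← Real.exp_add]
              congr 2
              push_cast
              ring
          _ < 1 * (n - r).factorial ^ (r * (n - r)) := by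
              gcongr
              rw [Real.exp_lt_one_iff]
              linarith
          _ = _ := one_mul _
      exact_mod_cast this)
  refine ⟨B, fun π => ?_⟩
  obtain ⟨j, hj⟩ := hB π
  refine ⟨j.1, ⟨r + j.2.val, by have := j.2.isLt; omega⟩, fun x => HasShortCycles.orbitSize_le ?_ x⟩
  exact not_not.1 hj

lemma exists_book_of_log_bounds (n : ℕ) (t : ℝ) (ht : t = Real.log (Real.log n)) (ht1 : 5 ≤ t)
    (hexp : (t + 1) * (3 * t + 2) < Real.exp t) (hy : 4 ≤ n / Real.log n) :
    ∃ hr : rOf n ≤ n,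
      ∃ B : (Fin (rOf n) ↪ Fin n) → Equiv.Perm (Fin (n - rOf n)), ∀ π : Equiv.Perm (Fin n),
        ∃ (j₀ : Fin (rOf n)) (j₁ : Fin n), ∀ x, orbitSize
          (pi1 n (rOf n) hr (π * Equiv.swap (Fin.castLE hr j₀) j₁) *
            B (firstContents n (rOf n) hr (π * Equiv.swap (Fin.castLE hr j₀) j₁))) x ≤
              ⌊(n : ℝ) / Real.log n * (t + 3)⌋₊ := by
  set x := Real.log n with hx
  have hn0 : (0 : ℝ) < n := by
    rcases Nat.eq_zero_or_pos n with rfl | h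
    · norm_num at hy
    · exact_mod_cast h
  have hx0 : 0 < x := by
    by_contra! h
    have := div_nonpos_of_nonneg_of_nonpos hn0.le h
    linarith
  have hxt : x = Real.exp t := by rw [ht, Real.exp_log hx0]
  have hnx : (n : ℝ) = Real.exp x := by rw [hx, Real.exp_log hn0]
  have hx2 : 2 ≤ x := by nlinarith
  set y := (n : ℝ) / x with hydef
  have hyx : y * x = n := div_mul_cancel₀ _ hx0.ne'
  have hrle : (rOf n : ℝ) ≤ y := Nat.floor_le (by positivity)
  have hrge : y - 1 < rOf n := Nat.sub_one_lt_floor y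
  have hyn : y ≤ n / 2 := by nlinarith
  have hr : rOf n ≤ n := by
    have : (rOf n : ℝ) ≤ n := by linarith
    exact_mod_cast this
  refine ⟨hr, ?_⟩
  set L := ⌊y * (t + 3)⌋₊ with hL
  set b := ⌈y * (t + 1)⌉₊ with hb
  set k := ⌈x / (t + 1)⌉₊ with hk
  have hL1 : y * (t + 3) - 1 < L := Nat.sub_one_lt_floor _
  have hb1 : y * (t + 1) ≤ b := Nat.le_ceil _
  have hb2 : (b : ℝ) < y * (t + 1) + 1 := Nat.ceil_lt_add_one (by positivity)
  have hk1 : x / (t + 1) ≤ k := Nat.le_ceil _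
  have hk2 : (k : ℝ) < x / (t + 1) + 1 := Nat.ceil_lt_add_one (by positivity)
  have hbL : b ≤ L := by
    have : (b : ℝ) ≤ L := by nlinarith
    exact_mod_cast this
  have hbk : n ≤ b * k := by
    have : (n : ℝ) ≤ b * k := by
      calc (n : ℝ) = (y * (t + 1)) * (x / (t + 1)) := by
            rw [← hyx]
            field_simp
        _ ≤ b * k := by gcongr
    exact_mod_cast this
  have hq1 : x⁻¹ ≤ 1 := inv_le_one_of_one_le₀ (by linarith)
  have hqw : x⁻¹ * (n : ℕ) ≤ (L - b : ℕ) := by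
    rw [Nat.cast_sub hbL, mul_comm, ← div_eq_mul_inv, ← hydef]
    nlinarith
  have hp := pow_mul_factorial_le_card_shortCycles (b := b) (w := L - b) (L := L) (M := n)
    (by omega) (by positivity) hq1 hqw k (Fin (n - rOf n)) (by simp; omega) (by simp)
  rw [Fintype.card_fin] at hp
  refine exists_book_of_factorial_lt n (rOf n) L hr _ hp ?_
  have hpow : Real.exp (-x + 2 * t + 2) ≤ x⁻¹ ^ k := by
    rw [hxt, ← Real.exp_neg, ← Real.exp_nat_mul, Real.exp_le_exp, ← hxt]
    have h1 : (t + 1) * (x / (t + 1)) = x := by field_simp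
    have h2 : 3 * t + 2 < x / (t + 1) := by
      rw [lt_div_iff₀ (by linarith), hxt]
      linarith
    have h3 : (k : ℝ) * t ≤ (x / (t + 1) + 1) * t := by gcongr
    nlinarith
  have hexp2 : (4 : ℝ) < Real.exp 2 := by
    have := Real.add_one_lt_exp (x := 1) one_ne_zero
    have h2 : Real.exp 2 = Real.exp 1 * Real.exp 1 := by rw [← Real.exp_add]; norm_num
    nlinarith
  have hM : y / 2 * (n / 2) ≤ (rOf n : ℝ) * (n - rOf n : ℕ) := by
    rw [Nat.cast_sub hr]
    apply mul_le_mul <;> linarith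
  calc (n : ℝ) * x = (x ^ 2 * (n : ℝ)⁻¹ * 4) * (y / 2 * (n / 2)) := by
        rw [hydef]
        field_simp
        ring
    _ < (x ^ 2 * (n : ℝ)⁻¹ * Real.exp 2) * (y / 2 * (n / 2)) := by
        gcongr
    _ = Real.exp (-x + 2 * t + 2) * (y / 2 * (n / 2)) := by
        rw [Real.exp_add, Real.exp_add, Real.exp_neg, ← hnx, two_mul, Real.exp_add, ← hxt]
        ring
    _ ≤ _ := by gcongr

/-- There are a function `f(n) → 0` and a threshold `N` such that for all
`n ≥ N`, with `r = ⌊n/ln n⌋`, there is a strategy book `B` assigning to each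
possible contents of the first `r` drawers a permutation of the remaining
`n − r` (relabelled) drawers, such that for every initial permutation `π` the
spy can swap the contents of some position `j₀` among the first `r` with some
position `j₁`, so that every cycle of `π₁(π′) ∘ B(s(π′))` (where
`π′ = π ∘ swap j₀ j₁`) has length at most `(n·ln ln n/ln n)·(1 + f n)`. -/
theorem exists_strategy_book :
    ∃ f : ℕ → ℝ, Filter.Tendsto f Filter.atTop (nhds 0) ∧
      ∃ N : ℕ, ∀ n : ℕ, N ≤ n →
        ∃ hr : rOf n ≤ n,
          ∃ B : (Fin (rOf n) ↪ Fin n) → Equiv.Perm (Fin (n - rOf n)),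
            ∀ π : Equiv.Perm (Fin n),
              ∃ (j₀ : Fin (rOf n)) (j₁ : Fin n),
                ∀ x, (orbitSize
                    (pi1 n (rOf n) hr (π * Equiv.swap (Fin.castLE hr j₀) j₁) *
                      B (firstContents n (rOf n) hr
                        (π * Equiv.swap (Fin.castLE hr j₀) j₁))) x : ℝ)
                  ≤ (n : ℝ) * Real.log (Real.log n) / Real.log n * (1 + f n) := by
  have hlog : Filter.Tendsto (fun n : ℕ => Real.log n) Filter.atTop Filter.atTop :=
    Real.tendsto_log_atTop.comp tendsto_natCast_atTop_atTop
  have hloglog : Filter.Tendsto (fun n : ℕ => Real.log (Real.log n)) Filter.atTop Filter.atTop :=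
    Real.tendsto_log_atTop.comp hlog
  refine ⟨fun n => 3 / Real.log (Real.log n), hloglog.const_div_atTop 3, ?_⟩
  have hexp : ∀ᶠ t : ℝ in Filter.atTop, (t + 1) * (3 * t + 2) < Real.exp t := by
    filter_upwards [(Real.tendsto_exp_div_pow_atTop 2).eventually_gt_atTop 10,
      Filter.eventually_ge_atTop 1] with t h1 h2
    rw [lt_div_iff₀ (by positivity)] at h1
    nlinarith
  have hdiv : ∀ᶠ x : ℝ in Filter.atTop, 4 * x ≤ Real.exp x := by
    filter_upwards [(Real.tendsto_exp_div_pow_atTop 1).eventually_gt_atTop 4,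
      Filter.eventually_ge_atTop 1] with t h1 h2
    rw [lt_div_iff₀ (by positivity)] at h1
    linarith
  rw [← Filter.eventually_atTop]
  filter_upwards [hloglog.eventually hexp, hlog.eventually hdiv,
    hloglog.eventually_ge_atTop 5, hlog.eventually_gt_atTop 0,
    Filter.eventually_gt_atTop 0] with n h1 h2 h3 h4 h5
  have hn0 : (0 : ℝ) < n := by exact_mod_cast h5
  rw [Real.exp_log hn0] at h2
  obtain ⟨hr, B, hB⟩ := exists_book_of_log_bounds n _ rfl h3 h1 ((le_div_iff₀ h4).2 h2)
  refine ⟨hr, B, fun π => ?_⟩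
  obtain ⟨j₀, j₁, hj⟩ := hB π
  refine ⟨j₀, j₁, fun x => ?_⟩
  have ht : 0 < Real.log (Real.log n) := by linarith
  calc _ ≤ ((⌊(n : ℝ) / Real.log n * (Real.log (Real.log n) + 3)⌋₊ : ℕ) : ℝ) := by
        exact_mod_cast hj x
    _ ≤ (n : ℝ) / Real.log n * (Real.log (Real.log n) + 3) := Nat.floor_le (by positivity)
    _ = _ := by
        field_simp
end

section
/- There exist a constant C > 0 and a threshold N such that for every n ≥ N the following holds. There exists r with 1 ≤ r ≤ n and a function B mapping each possible first-r-contents tuple (each injection Fin r ↪ Fin n) to a permutation of Fin(n−r) such that: for every permutation π of Fin n there exist positions j₀, j₁ ∈ Fin r such that, with π′ := π ∘ swap(j₀, j₁), the sum of r and the maximum cycle length of the composition π₁(π′) ∘ B(s(π′)) is at most C · n · ln ln n / ln n. (Here the swap is made within the first r positions, so π₁(π′) = π₁(π).) -/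
open Classical in
/-- The permutations of `α` all of whose cycles have length at most `ℓ`. -/
noncomputable def shortCyclePerms (α : Type) [Fintype α] (ℓ : ℕ) : Finset (Equiv.Perm α) :=
  Finset.univ.filter fun σ => ∀ x, orbitSize σ x ≤ ℓ

lemma mem_shortCyclePerms {α : Type} [Fintype α] {ℓ : ℕ} {σ : Equiv.Perm α} :
    σ ∈ shortCyclePerms α ℓ ↔ ∀ x, orbitSize σ x ≤ ℓ := by
  simp [shortCyclePerms]

lemma shortCyclePerms_eq_univ {α : Type} [Fintype α] {ℓ : ℕ} [DecidableEq α]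
    (h : Fintype.card α ≤ ℓ) : shortCyclePerms α ℓ = Finset.univ := by
  ext σ
  simp only [mem_shortCyclePerms, Finset.mem_univ, iff_true]
  intro x
  refine le_trans ?_ h
  rw [orbitSize, ← Nat.card_eq_fintype_card]
  exact Set.ncard_le_card _

section GlueCycle

variable {α : Type} [DecidableEq α]

/-- The permutation acting as a cycle along the list `l` and as `τ` off `l`. -/
def glueCycle (l : List α) (τ : Equiv.Perm {x // x ∉ l}) : Equiv.Perm α :=
  l.formPerm * Equiv.Perm.ofSubtype τ

lemma disjoint_formPerm_ofSubtype (l : List α) (τ : Equiv.Perm {x // x ∉ l}) :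
    l.formPerm.Disjoint (Equiv.Perm.ofSubtype τ) := by
  intro x
  by_cases hx : x ∈ l
  · exact Or.inr (Equiv.Perm.ofSubtype_apply_of_not_mem τ (by simpa using hx))
  · exact Or.inl (List.formPerm_apply_of_notMem hx)

lemma glueCycle_zpow (l : List α) (τ : Equiv.Perm {x // x ∉ l}) (i : ℤ) :
    glueCycle l τ ^ i = l.formPerm ^ i * Equiv.Perm.ofSubtype (τ ^ i) := by
  rw [glueCycle, (disjoint_formPerm_ofSubtype l τ).commute.mul_zpow, map_zpow]

lemma glueCycle_zpow_apply_of_mem {l : List α} (τ : Equiv.Perm {x // x ∉ l}) (i : ℤ) {x : α}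
    (hx : x ∈ l) : (glueCycle l τ ^ i) x = (l.formPerm ^ i) x := by
  rw [glueCycle_zpow, Equiv.Perm.mul_apply,
    Equiv.Perm.ofSubtype_apply_of_not_mem _ (by simpa using hx)]

lemma glueCycle_zpow_apply_of_notMem {l : List α} (τ : Equiv.Perm {x // x ∉ l}) (i : ℤ) {x : α}
    (hx : x ∉ l) : (glueCycle l τ ^ i) x = (τ ^ i) ⟨x, hx⟩ := by
  have hcomm := (disjoint_formPerm_ofSubtype l τ).commute
  rw [glueCycle, hcomm.mul_zpow, (hcomm.zpow_zpow i i).eq, Equiv.Perm.mul_apply,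
    Equiv.Perm.zpow_apply_eq_self_of_apply_eq_self (List.formPerm_apply_of_notMem hx),
    ← map_zpow]
  exact Equiv.Perm.ofSubtype_apply_of_mem (p := (· ∉ l)) (τ ^ i) hx

lemma orbitSize_glueCycle_le [Fintype α] {l : List α} (hl : l.Nodup)
    (τ : Equiv.Perm {x // x ∉ l}) {ℓ : ℕ}
    (hlen : l.length ≤ ℓ) (hτ : ∀ x, orbitSize τ x ≤ ℓ) (x : α) :
    orbitSize (glueCycle l τ) x ≤ ℓ := by
  by_cases hx : x ∈ l
  · have hsub : {z | (glueCycle l τ).SameCycle x z} ⊆ (l.toFinset : Set α) := by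
      rintro z ⟨i, rfl⟩
      rw [glueCycle_zpow_apply_of_mem τ i hx]
      have := (hl.isCycleOn_formPerm.1.perm_zpow i).mapsTo hx
      simpa using this
    calc orbitSize (glueCycle l τ) x ≤ (l.toFinset : Set α).ncard :=
          Set.ncard_le_ncard hsub (Set.toFinite _)
      _ ≤ ℓ := by
          rw [Set.ncard_coe_finset]
          exact (List.toFinset_card_le l).trans hlen
  · have hsub : {z | (glueCycle l τ).SameCycle x z} ⊆
        Subtype.val '' {z | τ.SameCycle ⟨x, hx⟩ z} := by
      rintro z ⟨i, rfl⟩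
      exact ⟨(τ ^ i) ⟨x, hx⟩, ⟨i, rfl⟩, (glueCycle_zpow_apply_of_notMem τ i hx).symm⟩
    calc orbitSize (glueCycle l τ) x ≤ (Subtype.val '' {z | τ.SameCycle ⟨x, hx⟩ z}).ncard :=
          Set.ncard_le_ncard hsub (Set.toFinite _)
      _ ≤ orbitSize τ ⟨x, hx⟩ := Set.ncard_image_le (Set.toFinite _)
      _ ≤ ℓ := hτ _

lemma glueCycle_injective (l : List α) : Function.Injective (glueCycle l) := fun _ _ h =>
  Equiv.Perm.ofSubtype_injective (mul_left_cancel h)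

lemma glueCycle_pow_apply_head {a : α} {l : List α} (hl : (a :: l).Nodup)
    (τ : Equiv.Perm {x // x ∉ a :: l}) (i : ℕ) :
    (glueCycle (a :: l) τ ^ i) a =
      (a :: l)[i % (a :: l).length]'(Nat.mod_lt _ (Nat.zero_lt_succ _)) := by
  have := glueCycle_zpow_apply_of_mem τ i (List.mem_cons_self (a := a) (l := l))
  rw [zpow_natCast, zpow_natCast] at this
  rw [this]
  exact List.formPerm_pow_apply_head _ _ hl i

/-- A permutation determines its cycle through `a`, listed from `a`. -/
lemma glueCycle_eq_imp {a : α} {l l' : List α} (hl : (a :: l).Nodup) (hl' : (a :: l').Nodup)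
    {τ : Equiv.Perm {x // x ∉ a :: l}} {τ' : Equiv.Perm {x // x ∉ a :: l'}}
    (h : glueCycle (a :: l) τ = glueCycle (a :: l') τ') : l = l' := by
  wlog hle : l.length ≤ l'.length generalizing l l'
  · exact (this hl' hl h.symm (le_of_not_ge hle)).symm
  have key : ∀ i, (a :: l)[i % (a :: l).length]'(Nat.mod_lt _ (Nat.zero_lt_succ _)) =
      (a :: l')[i % (a :: l').length]'(Nat.mod_lt _ (Nat.zero_lt_succ _)) := fun i => by
    rw [← glueCycle_pow_apply_head hl τ, ← glueCycle_pow_apply_head hl' τ', h]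
  have hlen : l.length = l'.length := by
    refine le_antisymm hle (not_lt.1 fun hlt => ?_)
    have h1 := key (l.length + 1)
    have h2 : (l.length + 1) % (a :: l').length = l.length + 1 :=
      Nat.mod_eq_of_lt (by simpa using hlt)
    simp only [List.length_cons, Nat.mod_self, List.getElem_cons_zero] at h1 h2
    simp only [h2, List.getElem_cons_succ] at h1
    exact (List.nodup_cons.1 hl').1 (h1 ▸ List.getElem_mem _)
  refine List.ext_getElem hlen fun i hi hi' => ?_
  have h1 := key (i + 1)
  have h2 : (i + 1) % (a :: l).length = i + 1 := Nat.mod_eq_of_lt (by simpa using hi)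
  have h3 : (i + 1) % (a :: l').length = i + 1 := Nat.mod_eq_of_lt (by simpa using hi')
  simpa only [h2, h3, List.getElem_cons_succ] using h1

end GlueCycle

/-- The list enumerating the values of an embedding avoiding `a`. -/
def embList {α : Type} {a : α} {j : ℕ} (e : Fin j ↪ {x : α // x ≠ a}) : List α :=
  List.ofFn fun i => (e i : α)

lemma nodup_cons_embList {α : Type} {a : α} {j : ℕ} (e : Fin j ↪ {x : α // x ≠ a}) :
    (a :: embList e).Nodup := by
  rw [List.nodup_cons, embList, List.mem_ofFn, List.nodup_ofFn]
  exact ⟨fun ⟨i, hi⟩ => (e i).2 hi, Subtype.val_injective.comp e.injective⟩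

lemma length_embList {α : Type} {a : α} {j : ℕ} (e : Fin j ↪ {x : α // x ≠ a}) :
    (embList e).length = j := List.length_ofFn

lemma card_notMem_embList {α : Type} [Fintype α] [DecidableEq α] {a : α} {j : ℕ}
    (e : Fin j ↪ {x : α // x ≠ a}) :
    Fintype.card {x // x ∉ a :: embList e} = Fintype.card α - (j + 1) := by
  have h : (a :: embList e).toFinset.card = j + 1 := by
    rw [List.toFinset_card_of_nodup (nodup_cons_embList e), List.length_cons, length_embList]
  rw [← h, ← Finset.card_compl, Fintype.card_subtype]
  congr 1
  ext x
  simp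

/-- Choosing the cycle through `a` first bounds below the number of permutations
with short cycles. -/
lemma sum_card_shortCyclePerms_le {α : Type} [Fintype α] [DecidableEq α] (a : α) (h : ℕ) :
    ∑ j ∈ Finset.Ico h (2 * h), ∑ e : Fin j ↪ {x : α // x ≠ a},
      (shortCyclePerms {x // x ∉ a :: embList e} (2 * h)).card ≤
      (shortCyclePerms α (2 * h)).card := by
  have : (((Finset.Ico h (2 * h)).sigma
      fun j => (Finset.univ : Finset (Fin j ↪ {x : α // x ≠ a}))).sigma fun p =>
        shortCyclePerms {x // x ∉ a :: embList p.2} (2 * h)).card ≤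
      (shortCyclePerms α (2 * h)).card := by
    refine Finset.card_le_card_of_injOn (fun p => glueCycle (a :: embList p.1.2) p.2) ?_ ?_
    · rintro ⟨⟨j, e⟩, τ⟩ hp
      simp only [Finset.coe_sigma, Set.mem_sigma_iff, Finset.mem_coe,
        Finset.mem_Ico, Finset.mem_univ, and_true] at hp
      rw [Finset.mem_coe, mem_shortCyclePerms]
      refine orbitSize_glueCycle_le (nodup_cons_embList e) τ ?_ (mem_shortCyclePerms.1 hp.2)
      rw [List.length_cons, length_embList]
      omega
    · rintro ⟨⟨j, e⟩, τ⟩ - ⟨⟨j', e'⟩, τ'⟩ - heq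
      have hl : embList e = embList e' :=
        glueCycle_eq_imp (nodup_cons_embList e) (nodup_cons_embList e') heq
      obtain rfl : j = j' := by rw [← length_embList e, hl, length_embList]
      obtain rfl : e = e' := by
        ext i
        exact congrFun (List.ofFn_injective hl) i
      obtain rfl : τ = τ' := glueCycle_injective _ heq
      rfl
  rwa [Finset.card_sigma, Finset.sum_sigma] at this

lemma le_card_shortCyclePerms {M h : ℕ} (hh : 0 < h) (hM : h ≤ M) (q : ℕ) :
    ∀ (α : Type) [Fintype α], Fintype.card α ≤ M → Fintype.card α ≤ (q + 1) * h →
      ((Fintype.card α).factorial : ℝ) * ((h : ℝ) / M) ^ q ≤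
        (shortCyclePerms α (2 * h)).card := by
  have hM0 : (0 : ℝ) < M := by exact_mod_cast hh.trans_le hM
  have hp0 : (0 : ℝ) ≤ (h : ℝ) / M := by positivity
  have hp1 : (h : ℝ) / M ≤ 1 := (div_le_one hM0).2 (by exact_mod_cast hM)
  have small : ∀ (q : ℕ) (α : Type) [Fintype α], Fintype.card α ≤ 2 * h →
      ((Fintype.card α).factorial : ℝ) * ((h : ℝ) / M) ^ q ≤
        (shortCyclePerms α (2 * h)).card := by
    intro q α _ hα
    classical
    rw [shortCyclePerms_eq_univ hα, Finset.card_univ, Fintype.card_perm]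
    exact mul_le_of_le_one_right (by positivity) (pow_le_one₀ hp0 hp1)
  induction q with
  | zero => exact fun α _ _ hα => small 0 α (by omega)
  | succ q ih =>
    intro α _ hαM hα
    classical
    rcases le_or_gt (Fintype.card α) (2 * h) with hs | hs
    · exact small _ α hs
    obtain ⟨m, hm⟩ : ∃ m, Fintype.card α = m + 1 := ⟨Fintype.card α - 1, by omega⟩
    obtain ⟨a⟩ : Nonempty α := Fintype.card_pos_iff.1 (by omega)
    have hterm : ∀ j ∈ Finset.Ico h (2 * h), (m.factorial : ℝ) * ((h : ℝ) / M) ^ q ≤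
        ((∑ e : Fin j ↪ {x : α // x ≠ a},
          (shortCyclePerms {x // x ∉ a :: embList e} (2 * h)).card : ℕ) : ℝ) := by
      intro j hj
      rw [Finset.mem_Ico] at hj
      have hcard : Fintype.card (Fin j ↪ {x : α // x ≠ a}) = m.descFactorial j := by
        rw [Fintype.card_embedding_eq, Fintype.card_fin]
        congr 1
        rw [Fintype.card_subtype, Finset.filter_ne', Finset.card_erase_of_mem (Finset.mem_univ a),
          Finset.card_univ, hm, Nat.add_sub_cancel]
      have hone : ∀ e : Fin j ↪ {x : α // x ≠ a},
          ((m - j).factorial : ℝ) * ((h : ℝ) / M) ^ q ≤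
            (shortCyclePerms {x // x ∉ a :: embList e} (2 * h)).card := by
        intro e
        have hc : Fintype.card {x // x ∉ a :: embList e} = m - j := by
          rw [card_notMem_embList, hm]; omega
        have := ih {x // x ∉ a :: embList e} (by omega) (by
          rw [hc]
          have : (q + 1 + 1) * h = (q + 1) * h + h := by ring
          omega)
        rwa [hc] at this
      rw [← Nat.factorial_mul_descFactorial (show j ≤ m by omega)]
      push_cast
      calc _ = ∑ _e : Fin j ↪ {x : α // x ≠ a}, ((m - j).factorial : ℝ) * ((h : ℝ) / M) ^ q := by
            rw [Finset.sum_const, Finset.card_univ, hcard, nsmul_eq_mul]; ring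
        _ ≤ _ := Finset.sum_le_sum fun e _ => hone e
    have hmM : ((m + 1 : ℕ) : ℝ) ≤ M := by exact_mod_cast hm ▸ hαM
    calc ((Fintype.card α).factorial : ℝ) * ((h : ℝ) / M) ^ (q + 1)
        = ((m + 1 : ℕ) : ℝ) / M * (h * ((m.factorial : ℝ) * ((h : ℝ) / M) ^ q)) := by
          rw [hm, Nat.factorial_succ]; push_cast; ring
      _ ≤ h * ((m.factorial : ℝ) * ((h : ℝ) / M) ^ q) :=
          mul_le_of_le_one_left (by positivity) ((div_le_one hM0).2 hmM)
      _ = ∑ _j ∈ Finset.Ico h (2 * h), (m.factorial : ℝ) * ((h : ℝ) / M) ^ q := by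
          rw [Finset.sum_const, Nat.card_Ico, nsmul_eq_mul]; congr 2; omega
      _ ≤ ∑ j ∈ Finset.Ico h (2 * h), ((∑ e : Fin j ↪ {x : α // x ≠ a},
          (shortCyclePerms {x // x ∉ a :: embList e} (2 * h)).card : ℕ) : ℝ) :=
          Finset.sum_le_sum hterm
      _ ≤ (shortCyclePerms α (2 * h)).card := by
          exact_mod_cast sum_card_shortCyclePerms_le a h

/-- A union bound: if each `ω` is served by a random value at any of `K` points with
probability at least `δ`, then one function serves all `ω`. -/
lemma exists_fun_forall_exists_mem {X G Ω : Type*} [Fintype X] [DecidableEq X]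
    [Fintype G] [DecidableEq G] [Nonempty G] [Fintype Ω]
    (S : Ω → Finset X) (good : Ω → Finset G) (K : ℕ) (δ : ℝ)
    (hS : ∀ ω, (S ω).card = K) (hgood : ∀ ω, δ * Fintype.card G ≤ (good ω).card)
    (hlt : (Fintype.card Ω : ℝ) * (1 - δ) ^ K < 1) :
    ∃ B : X → G, ∀ ω, ∃ x ∈ S ω, B x ∈ good ω := by
  by_contra! hcon
  let bad : Ω → Finset (X → G) := fun ω =>
    Fintype.piFinset fun x => if x ∈ S ω then (good ω)ᶜ else Finset.univ
  have hcover : (Finset.univ : Finset (X → G)) ⊆ Finset.univ.biUnion bad := by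
    intro B _
    obtain ⟨ω, hω⟩ := hcon B
    refine Finset.mem_biUnion.2 ⟨ω, Finset.mem_univ _, Fintype.mem_piFinset.2 fun x => ?_⟩
    split_ifs with hx
    · exact Finset.mem_compl.2 (hω x hx)
    · exact Finset.mem_univ _
  have hG : (0 : ℝ) < Fintype.card G := by exact_mod_cast Fintype.card_pos
  have hbad : ∀ ω, ((bad ω).card : ℝ) ≤ (1 - δ) ^ K * (Fintype.card G : ℝ) ^ Fintype.card X := by
    intro ω
    have hc : (((good ω)ᶜ.card : ℕ) : ℝ) ≤ (1 - δ) * Fintype.card G := by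
      rw [Finset.card_compl, Nat.cast_sub (Finset.card_le_univ _)]
      linarith [hgood ω]
    have hK : K + (S ω)ᶜ.card = Fintype.card X := by rw [← hS ω, Finset.card_add_card_compl]
    have hcard : (bad ω).card = (good ω)ᶜ.card ^ K * Fintype.card G ^ (S ω)ᶜ.card := by
      simp only [bad, Fintype.card_piFinset]
      rw [← Finset.prod_mul_prod_compl (S ω)]
      rw [Finset.prod_congr rfl (g := fun _ => (good ω)ᶜ.card) fun x hx => by rw [if_pos hx],
        Finset.prod_congr (s₁ := (S ω)ᶜ) rfl (g := fun _ => Fintype.card G) fun x hx => by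
          rw [if_neg (Finset.mem_compl.1 hx), Finset.card_univ]]
      rw [Finset.prod_const, Finset.prod_const, hS]
    rw [hcard, ← hK, pow_add, ← mul_assoc, ← mul_pow]
    push_cast
    gcongr
  have htotal : (Fintype.card G : ℝ) ^ Fintype.card X ≤
      Fintype.card Ω * ((1 - δ) ^ K * (Fintype.card G : ℝ) ^ Fintype.card X) := by
    calc (Fintype.card G : ℝ) ^ Fintype.card X = ((Finset.univ : Finset (X → G)).card : ℝ) := by
          rw [Finset.card_univ, Fintype.card_fun]; push_cast; rfl
      _ ≤ ((Finset.univ.biUnion bad).card : ℝ) := by exact_mod_cast Finset.card_le_card hcover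
      _ ≤ ∑ ω, ((bad ω).card : ℝ) := by exact_mod_cast Finset.card_biUnion_le
      _ ≤ ∑ _ω : Ω, (1 - δ) ^ K * (Fintype.card G : ℝ) ^ Fintype.card X :=
          Finset.sum_le_sum fun ω _ => hbad ω
      _ = _ := by rw [Finset.sum_const, Finset.card_univ, nsmul_eq_mul]
  have : (0 : ℝ) < (Fintype.card G : ℝ) ^ Fintype.card X := by positivity
  nlinarith

lemma firstContents_mul_swap {n r : ℕ} (h : r ≤ n) (π : Equiv.Perm (Fin n)) (j₀ j₁ : Fin r) :
    firstContents n r h (π * Equiv.swap (Fin.castLE h j₀) (Fin.castLE h j₁)) =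
      (Equiv.swap j₀ j₁).toEmbedding.trans (firstContents n r h π) := by
  refine Function.Embedding.ext fun j => ?_
  change π (Equiv.swap (Fin.castLE h j₀) (Fin.castLE h j₁) (Fin.castLE h j)) =
    π (Fin.castLE h (Equiv.swap j₀ j₁ j))
  rw [(Fin.castLE_injective h).swap_apply]

lemma orderIsoOfFin_symm_congr {k m : ℕ} {s t : Finset (Fin k)} (hs : s.card = m)
    (ht : t.card = m) {x y : Fin k} (hx : x ∈ s) (hy : y ∈ t) (hst : s = t) (hxy : x = y) :
    (s.orderIsoOfFin hs).symm ⟨x, hx⟩ = (t.orderIsoOfFin ht).symm ⟨y, hy⟩ := by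
  subst hst hxy
  rfl

lemma pi1_mul_swap {n r : ℕ} (h : r ≤ n) (π : Equiv.Perm (Fin n)) (j₀ j₁ : Fin r) :
    pi1 n r h (π * Equiv.swap (Fin.castLE h j₀) (Fin.castLE h j₁)) = pi1 n r h π := by
  ext1 i
  refine orderIsoOfFin_symm_congr (restValues_card n r h _) (restValues_card n r h π)
    (mem_restValues n r h _ i) (mem_restValues n r h π i) ?_ ?_
  · rw [restValues, restValues, firstContents_mul_swap, ← Finset.map_map,
      Finset.map_univ_equiv]
  · rw [Equiv.Perm.mul_apply, Equiv.swap_apply_of_ne_of_ne]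
    all_goals
      intro hi
      have := congrArg Fin.val hi
      simp only [Fin.val_castLE] at this
      omega

/-- The contents of the first `2 * h` drawers reachable by swapping one of the first `h`
drawers with one of the next `h`. -/
def crossSwapContents {n h : ℕ} (hr : 2 * h ≤ n) (π : Equiv.Perm (Fin n)) :
    Finset (Fin (2 * h) ↪ Fin n) :=
  Finset.univ.image fun p : Fin h × Fin h =>
    firstContents n (2 * h) hr (π *
      Equiv.swap (Fin.castLE hr ⟨p.1, by omega⟩) (Fin.castLE hr ⟨h + p.2, by omega⟩))

lemma card_crossSwapContents {n h : ℕ} (hr : 2 * h ≤ n) (π : Equiv.Perm (Fin n)) :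
    (crossSwapContents hr π).card = h ^ 2 := by
  rw [crossSwapContents, Finset.card_image_of_injective, Finset.card_univ, Fintype.card_prod,
    Fintype.card_fin, sq]
  rintro ⟨a, b⟩ ⟨c, d⟩ heq
  simp only [firstContents_mul_swap] at heq
  have hval : ∀ j, Equiv.swap (⟨a, by omega⟩ : Fin (2 * h)) ⟨h + b, by omega⟩ j =
      Equiv.swap (⟨c, by omega⟩ : Fin (2 * h)) ⟨h + d, by omega⟩ j := fun j =>
    (firstContents n (2 * h) hr π).injective (DFunLike.congr_fun heq j)
  have h1 := hval ⟨a, by omega⟩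
  rw [Equiv.swap_apply_left] at h1
  have hac : a = c := by
    by_contra hne
    rw [Equiv.swap_apply_of_ne_of_ne] at h1
    · simp only [Fin.mk.injEq] at h1; omega
    · simpa [Fin.ext_iff] using hne
    · simp only [ne_eq, Fin.mk.injEq]; omega
  subst hac
  rw [Equiv.swap_apply_left] at h1
  simp only [Fin.mk.injEq, Nat.add_left_cancel_iff] at h1
  rw [Fin.ext h1]

/-- If short cycles are dense enough, a strategy book achieving `2 * h` exists. -/
lemma exists_book_of_card_lt {n h : ℕ} (hr : 2 * h ≤ n) (δ : ℝ)
    (hδ : δ * ((n - 2 * h).factorial : ℝ) ≤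
      (shortCyclePerms (Fin (n - 2 * h)) (2 * h)).card)
    (hlt : (n.factorial : ℝ) * (1 - δ) ^ (h ^ 2) < 1) :
    ∃ B : (Fin (2 * h) ↪ Fin n) → Equiv.Perm (Fin (n - 2 * h)),
      ∀ π : Equiv.Perm (Fin n), ∃ j₀ j₁ : Fin (2 * h), ∀ x,
        orbitSize (pi1 n (2 * h) hr (π * Equiv.swap (Fin.castLE hr j₀) (Fin.castLE hr j₁)) *
          B (firstContents n (2 * h) hr
            (π * Equiv.swap (Fin.castLE hr j₀) (Fin.castLE hr j₁)))) x ≤ 2 * h := by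
  obtain ⟨B, hB⟩ := exists_fun_forall_exists_mem (crossSwapContents hr)
    (fun π => (shortCyclePerms (Fin (n - 2 * h)) (2 * h)).map
      (Equiv.mulLeft (pi1 n (2 * h) hr π)⁻¹).toEmbedding) (h ^ 2) δ
    (card_crossSwapContents hr)
    (fun π => by rwa [Finset.card_map, Fintype.card_perm, Fintype.card_fin])
    (by rwa [Fintype.card_perm, Fintype.card_fin])
  refine ⟨B, fun π => ?_⟩
  obtain ⟨f, hf, hgood⟩ := hB π
  obtain ⟨p, -, rfl⟩ := Finset.mem_image.1 hf
  refine ⟨⟨p.1, by omega⟩, ⟨h + p.2, by omega⟩, ?_⟩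
  obtain ⟨σ, hσ, hσB⟩ := Finset.mem_map.1 hgood
  rw [pi1_mul_swap, ← hσB]
  simpa using mem_shortCyclePerms.1 hσ

lemma factorial_mul_one_sub_pow_lt_one {n K : ℕ} {δ : ℝ} (hn : 0 < n) (hδ : δ ≤ 1)
    (h : n * Real.log n < δ * K) : (n.factorial : ℝ) * (1 - δ) ^ K < 1 := by
  have hn0 : (0 : ℝ) < n := by exact_mod_cast hn
  calc (n.factorial : ℝ) * (1 - δ) ^ K
      ≤ (n : ℝ) ^ n * Real.exp (-δ) ^ K := by
        refine mul_le_mul (by exact_mod_cast Nat.factorial_le_pow n)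
          (pow_le_pow_left₀ (by linarith) (Real.one_sub_le_exp_neg δ) K)
          (pow_nonneg (by linarith) K) (by positivity)
    _ = Real.exp (n * Real.log n - δ * K) := by
        rw [sub_eq_add_neg, Real.exp_add, Real.exp_nat_mul, Real.exp_log hn0, ← Real.exp_nat_mul]
        congr 2
        ring
    _ < 1 := by
        rw [← Real.exp_zero]
        exact Real.exp_lt_exp.2 (by linarith)

lemma eventually_log_bounds : ∀ᶠ n : ℕ in Filter.atTop,
    1 ≤ Real.log (Real.log n) ∧ 10 * Real.log (Real.log n) ≤ Real.log n ∧
      Real.log n ^ 3 < Real.exp (3 / 4 * Real.log n) := by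
  have hreal : ∀ᶠ y : ℝ in Filter.atTop,
      1 ≤ Real.log y ∧ 10 * Real.log y ≤ y ∧ y ^ 3 < Real.exp (3 / 4 * y) := by
    have h1 := Real.isLittleO_log_id_atTop.bound (show (0 : ℝ) < 1 / 10 by norm_num)
    have h2 := (isLittleO_pow_exp_pos_mul_atTop 3 (show (0 : ℝ) < 3 / 4 by norm_num)).bound
      (show (0 : ℝ) < 1 / 2 by norm_num)
    filter_upwards [h1, h2, Real.tendsto_log_atTop.eventually_ge_atTop 1,
      Filter.eventually_gt_atTop 0] with y hy1 hy2 hy3 hy4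
    rw [id, Real.norm_of_nonneg (by linarith), Real.norm_of_nonneg hy4.le] at hy1
    rw [Real.norm_of_nonneg (by positivity), Real.norm_of_nonneg (by positivity)] at hy2
    have := Real.exp_pos (3 / 4 * y)
    exact ⟨hy3, by linarith, by linarith⟩
  exact (Real.tendsto_log_atTop.comp tendsto_natCast_atTop_atTop).eventually hreal

/-- There are a constant `C > 0` and a threshold `N` such that for all `n ≥ N`
there are `1 ≤ r ≤ n` and a strategy book `B` assigning to each possible
contents of the first `r` drawers a permutation of the remaining `n − r`
(relabelled) drawers, such that for every initial permutation `π` the spy can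
swap the contents of two of the first `r` positions `j₀, j₁`, so that `r` plus
the maximum cycle length of `π₁(π′) ∘ B(s(π′))` (where `π′ = π ∘ swap j₀ j₁`)
is at most `C · n · ln ln n / ln n`. -/
theorem exists_efficient_strategy_book :
    ∃ C : ℝ, 0 < C ∧
      ∃ N : ℕ, ∀ n : ℕ, N ≤ n →
        ∃ r : ℕ, 1 ≤ r ∧
          ∃ hr : r ≤ n,
            ∃ B : (Fin r ↪ Fin n) → Equiv.Perm (Fin (n - r)),
              ∀ π : Equiv.Perm (Fin n),
                ∃ j₀ j₁ : Fin r,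
                  (r : ℝ) +
                    ((Finset.univ.sup fun x : Fin (n - r) => orbitSize
                      (pi1 n r hr (π * Equiv.swap (Fin.castLE hr j₀) (Fin.castLE hr j₁)) *
                        B (firstContents n r hr
                          (π * Equiv.swap (Fin.castLE hr j₀) (Fin.castLE hr j₁)))) x : ℕ) : ℝ)
                  ≤ C * (n : ℝ) * Real.log (Real.log n) / Real.log n := by
  obtain ⟨N, hN⟩ := Filter.eventually_atTop.1
    (eventually_log_bounds.and (Filter.eventually_gt_atTop 0))
  refine ⟨20, by norm_num, N, fun n hn => ?_⟩
  obtain ⟨⟨hLL, hL10, hL3⟩, hn0⟩ := hN n hn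
  have hnR : (0 : ℝ) < n := by exact_mod_cast hn0
  have hexp : Real.exp (Real.log n) = n := Real.exp_log hnR
  have hLn : Real.log n ≤ n := Real.log_le_self hnR.le
  have hexpLL : Real.exp (Real.log (Real.log n)) = Real.log n := Real.exp_log (by linarith)
  set L := Real.log n
  set LL := Real.log L
  have hL0 : 0 < L := by linarith
  set h := ⌈4 * n * LL / L⌉₊
  have hlow : 4 * n * LL / L ≤ h := Nat.le_ceil _
  have hone : 1 ≤ n * LL / L := by
    rw [le_div_iff₀ hL0]
    nlinarith
  have hup : (h : ℝ) ≤ 5 * (n * LL / L) := by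
    have h1 : (h : ℝ) < 4 * n * LL / L + 1 := Nat.ceil_lt_add_one (by positivity)
    have h2 : 4 * n * LL / L = 4 * (n * LL / L) := by ring
    linarith
  have hr : 2 * h ≤ n := by
    have h1 : 10 * (n * LL / L) ≤ n := by
      rw [← mul_div_assoc, div_le_iff₀ hL0]
      nlinarith
    have : (2 : ℝ) * h ≤ n := by linarith
    exact_mod_cast this
  have hh0 : 0 < h := by
    have : (0 : ℝ) < h := by
      have h2 : 4 * n * LL / L = 4 * (n * LL / L) := by ring
      linarith
    exact_mod_cast this
  have hhR : (0 : ℝ) < h := by exact_mod_cast hh0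
  have hhL : (n : ℝ) / L ≤ h := by
    refine le_trans ?_ hlow
    gcongr
    nlinarith
  set δ := ((h : ℝ) / n) ^ (n / h)
  have hδ1 : δ ≤ 1 := pow_le_one₀ (by positivity)
    ((div_le_one hnR).2 (by exact_mod_cast (by omega : h ≤ n)))
  have hδ : Real.exp (-(L / 4)) ≤ δ := by
    have hq : ((n / h : ℕ) : ℝ) * LL ≤ L / 4 := by
      have h1 : ((n / h : ℕ) : ℝ) ≤ n / h := Nat.cast_div_le
      have h2 : (n : ℝ) / h * LL ≤ L / 4 := by
        rw [div_mul_eq_mul_div, div_le_iff₀ hhR]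
        rw [div_le_iff₀ hL0] at hlow
        linarith
      exact (mul_le_mul_of_nonneg_right h1 (by linarith)).trans h2
    calc Real.exp (-(L / 4)) ≤ Real.exp ((n / h : ℕ) * -LL) := by
          apply Real.exp_le_exp.2; linarith
      _ = Real.exp (-LL) ^ (n / h) := Real.exp_nat_mul _ _
      _ ≤ δ := by
          refine pow_le_pow_left₀ (Real.exp_pos _).le ?_ _
          rw [Real.exp_neg, hexpLL, le_div_iff₀ hnR, inv_mul_eq_div]
          exact hhL
  have hsmall : (n.factorial : ℝ) * (1 - δ) ^ (h ^ 2) < 1 := by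
    refine factorial_mul_one_sub_pow_lt_one hn0 hδ1 ?_
    have hsplit : (n : ℝ) = Real.exp (3 / 4 * L) * Real.exp (L / 4) := by
      rw [← Real.exp_add, show 3 / 4 * L + L / 4 = L by ring, hexp]
    calc n * L < Real.exp (-(L / 4)) * (n / L) ^ 2 := by
          rw [Real.exp_neg, inv_mul_eq_div, lt_div_iff₀ (Real.exp_pos _), div_pow,
            lt_div_iff₀ (by positivity)]
          have : L ^ 3 * Real.exp (L / 4) < n := by
            rw [hsplit]; exact mul_lt_mul_of_pos_right hL3 (Real.exp_pos _)
          nlinarith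
      _ ≤ δ * (h ^ 2 : ℕ) := by
          push_cast
          gcongr
  obtain ⟨B, hB⟩ := exists_book_of_card_lt hr δ (by
    have := le_card_shortCyclePerms hh0 (show h ≤ n by omega) (n / h) (Fin (n - 2 * h))
      (by rw [Fintype.card_fin]; omega) (by
        rw [Fintype.card_fin, mul_comm (n / h + 1)]
        exact (Nat.sub_le _ _).trans (Nat.lt_mul_div_succ n hh0).le)
    rwa [Fintype.card_fin, mul_comm] at this) hsmall
  refine ⟨2 * h, by omega, hr, B, fun π => ?_⟩
  obtain ⟨j₀, j₁, hj⟩ := hB π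
  refine ⟨j₀, j₁, ?_⟩
  refine (add_le_add_right (Nat.cast_le.2 (Finset.sup_le fun x _ => hj x)) _).trans ?_
  have h2 : 20 * n * LL / L = 20 * (n * LL / L) := by ring
  push_cast
  linarith
end
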